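/- arXiv:2602.03831 — 2 statements merged into one kernel-verified Lean document; each statement's English description precedes it below -/
import Mathlib

section
/- Let μ be an isotropic log-concave probability measure on ℝ^n. Then Γ(μ) ≤ C n^{3/2}, where C > 0 is an absolute constant (one may take C = 17). That is, for every convex body A ⊂ ℝ^n, the μ-perimeter satisfies μ⁺(∂A) ≤ C n^{3/2}. -/
open MeasureTheory Metric Filter Set Pointwise

noncomputable section

abbrev Euc (n : ℕ) := EuclideanSpace ℝ (Fin n)

/-- `f` is a log-concave (nonnegative) function on `ℝ^n`. -/
def IsLogConcaveFn {n : ℕ} (f : Euc n → ℝ) : Prop :=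
  (∀ x, 0 ≤ f x) ∧
  ∀ x y : Euc n, ∀ τ : ℝ, 0 ≤ τ → τ ≤ 1 →
    f x ^ τ * f y ^ (1 - τ) ≤ f (τ • x + (1 - τ) • y)

/-- The `μ`-perimeter `μ⁺(∂A) = liminf_{ε→0⁺} μ((A + εB₂ⁿ) \ A) / ε`. -/
def muPerim {n : ℕ} (μ : Measure (Euc n)) (A : Set (Euc n)) : ℝ :=
  liminf (fun ε : ℝ => (μ ((A + closedBall (0 : Euc n) ε) \ A)).toReal / ε)
    (nhdsWithin 0 (Ioi 0))

/-- A convex body: compact convex set with nonempty interior. -/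
def IsConvexBody {n : ℕ} (A : Set (Euc n)) : Prop :=
  Convex ℝ A ∧ IsCompact A ∧ (interior A).Nonempty



lemma interval_bm {I J H : Set ℝ} {a b : ℝ} (ha : 0 < a) (hb : 0 < b)
    (hI : I.Nonempty) (hJ : J.Nonempty) (hH : H.OrdConnected)
    (hs : ∀ x ∈ I, ∀ y ∈ J, a * x + b * y ∈ H) :
    ENNReal.ofReal a * volume I + ENNReal.ofReal b * volume J ≤ volume H := by
  have key : ∀ x ∈ I, ∀ x' ∈ I, ∀ y ∈ J, ∀ y' ∈ J,
      ENNReal.ofReal a * edist x x' + ENNReal.ofReal b * edist y y' ≤ volume H := by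
    have key1 : ∀ x ∈ I, ∀ x' ∈ I, ∀ y ∈ J, ∀ y' ∈ J, x ≤ x' → y ≤ y' →
        ENNReal.ofReal a * edist x x' + ENNReal.ofReal b * edist y y' ≤ volume H := by
      intro x hx x' hx' y hy y' hy' hxx hyy
      have h1 := hH.out (hs x hx y hy) (hs x' hx' y' hy')
      have h2 := measure_mono (μ := volume) h1
      rw [Real.volume_Icc] at h2
      refine le_trans (le_of_eq ?_) h2
      rw [edist_dist, edist_dist, ← ENNReal.ofReal_mul ha.le, ← ENNReal.ofReal_mul hb.le,
        ← ENNReal.ofReal_add (by positivity) (by positivity)]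
      congr 1
      rw [dist_comm x, dist_comm y, Real.dist_eq, Real.dist_eq, abs_of_nonneg (by linarith),
        abs_of_nonneg (by linarith)]
      ring
    intro x hx x' hx' y hy y' hy'
    rcases le_total x x' with h1 | h1 <;> rcases le_total y y' with h2 | h2
    · exact key1 x hx x' hx' y hy y' hy' h1 h2
    · rw [edist_comm y]; exact key1 x hx x' hx' y' hy' y hy h1 h2
    · rw [edist_comm x]; exact key1 x' hx' x hx y hy y' hy' h1 h2
    · rw [edist_comm x, edist_comm y]; exact key1 x' hx' x hx y' hy' y hy h1 h2
  by_cases hV : volume H = ⊤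
  · rw [hV]; exact le_top
  have ha0 : ENNReal.ofReal a ≠ 0 := by simpa using ha
  have hb0 : ENNReal.ofReal b ≠ 0 := by simpa using hb
  have step1 : ∀ y ∈ J, ∀ y' ∈ J,
      ENNReal.ofReal a * volume I + ENNReal.ofReal b * edist y y' ≤ volume H := by
    intro y hy y' hy'
    have : volume I ≤ (volume H - ENNReal.ofReal b * edist y y') / ENNReal.ofReal a := by
      refine (Real.volume_le_diam I).trans (ediam_le fun x hx x' hx' => ?_)
      rw [ENNReal.le_div_iff_mul_le (Or.inl ha0) (Or.inl ENNReal.ofReal_ne_top), mul_comm]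
      exact ENNReal.le_sub_of_add_le_right (ENNReal.mul_ne_top ENNReal.ofReal_ne_top
        (edist_ne_top _ _)) (key x hx x' hx' y hy y' hy')
    rw [ENNReal.le_div_iff_mul_le (Or.inl ha0) (Or.inl ENNReal.ofReal_ne_top), mul_comm] at this
    obtain ⟨x, hx⟩ := hI
    have h3 : ENNReal.ofReal b * edist y y' ≤ volume H :=
      le_trans le_add_self (key x hx x hx y hy y' hy')
    calc _ ≤ (volume H - ENNReal.ofReal b * edist y y') + ENNReal.ofReal b * edist y y' := by
          gcongr
      _ = _ := tsub_add_cancel_of_le h3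
  obtain ⟨y0, hy0⟩ := hJ
  have h4 : ENNReal.ofReal a * volume I ≤ volume H :=
      le_trans le_self_add (step1 y0 hy0 y0 hy0)
  have : volume J ≤ (volume H - ENNReal.ofReal a * volume I) / ENNReal.ofReal b := by
    refine (Real.volume_le_diam J).trans (ediam_le fun x hx x' hx' => ?_)
    rw [ENNReal.le_div_iff_mul_le (Or.inl hb0) (Or.inl ENNReal.ofReal_ne_top), mul_comm]
    exact ENNReal.le_sub_of_add_le_left (ne_top_of_le_ne_top hV h4) (step1 x hx x' hx')
  rw [ENNReal.le_div_iff_mul_le (Or.inl hb0) (Or.inl ENNReal.ofReal_ne_top), mul_comm] at this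
  calc _ ≤ ENNReal.ofReal a * volume I + (volume H - ENNReal.ofReal a * volume I) := by
          gcongr
      _ = _ := add_tsub_cancel_of_le h4

lemma meas_of_ordConnected {f : ℝ → ℝ} (hf : ∀ t, {x | t < f x}.OrdConnected) : Measurable f :=
  measurable_of_Ioi fun t => (hf t).measurableSet

lemma pl1_norm {f g h : ℝ → ℝ} {a b : ℝ} (ha : 0 < a) (hb : 0 < b) (hab : a + b = 1)
    (f0 : ∀ x, 0 ≤ f x) (g0 : ∀ x, 0 ≤ g x) (h0 : ∀ x, 0 ≤ h x)
    (f1 : ∀ x, f x ≤ 1) (g1 : ∀ x, g x ≤ 1)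
    (fs : ∀ t < 1, ∃ x, t < f x) (gs : ∀ t < 1, ∃ x, t < g x)
    (fo : ∀ t, {x | t < f x}.OrdConnected) (go : ∀ t, {x | t < g x}.OrdConnected)
    (ho : ∀ t, {x | t < h x}.OrdConnected)
    (hyp : ∀ x y, f x ^ a * g y ^ b ≤ h (a * x + b * y)) :
    ENNReal.ofReal a * (∫⁻ x, ENNReal.ofReal (f x)) +
      ENNReal.ofReal b * (∫⁻ x, ENNReal.ofReal (g x)) ≤ ∫⁻ x, ENNReal.ofReal (h x) := by
  rw [lintegral_eq_lintegral_meas_lt volume (ae_of_all _ f0) (meas_of_ordConnected fo).aemeasurable,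
    lintegral_eq_lintegral_meas_lt volume (ae_of_all _ g0) (meas_of_ordConnected go).aemeasurable,
    lintegral_eq_lintegral_meas_lt volume (ae_of_all _ h0) (meas_of_ordConnected ho).aemeasurable]
  have mf : Measurable fun t => volume {x | t < f x} :=
    Antitone.measurable fun s t hst => measure_mono fun x hx => lt_of_le_of_lt hst hx
  have mg : Measurable fun t => volume {x | t < g x} :=
    Antitone.measurable fun s t hst => measure_mono fun x hx => lt_of_le_of_lt hst hx
  rw [← lintegral_const_mul _ mf, ← lintegral_const_mul _ mg, ← lintegral_add_left (by fun_prop)]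
  refine setLIntegral_mono' measurableSet_Ioi fun t ht => ?_
  rcases lt_or_ge t 1 with h1 | h1
  · refine interval_bm ha hb (fs t h1) (gs t h1) (ho t) fun x hx y hy => ?_
    have ht' : 0 < t := ht
    refine lt_of_lt_of_le ?_ (hyp x y)
    calc t = t ^ a * t ^ b := by rw [← Real.rpow_add ht', hab, Real.rpow_one]
      _ < f x ^ a * g y ^ b := by
        have := Real.rpow_lt_rpow ht'.le hx ha
        have := Real.rpow_lt_rpow ht'.le hy hb
        have := Real.rpow_pos_of_pos ht' a
        have := Real.rpow_pos_of_pos ht' b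
        gcongr
  · have e1 : {x | t < f x} = ∅ := by
      ext x; simp; exact (f1 x).trans h1
    have e2 : {x | t < g x} = ∅ := by
      ext x; simp; exact (g1 x).trans h1
    simp [e1, e2]

lemma ennreal_amgm {a b : ℝ} (ha : 0 < a) (hb : 0 < b) (hab : a + b = 1) (u v : ENNReal) :
    u ^ a * v ^ b ≤ ENNReal.ofReal a * u + ENNReal.ofReal b * v := by
  have ha0 : ENNReal.ofReal a ≠ 0 := by simpa using ha
  have hb0 : ENNReal.ofReal b ≠ 0 := by simpa using hb
  by_cases hu : u = ⊤
  · rw [hu, ENNReal.mul_top ha0]; simp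
  by_cases hv : v = ⊤
  · rw [hv, ENNReal.mul_top hb0]; simp
  lift u to NNReal using hu
  lift v to NNReal using hv
  have := NNReal.geom_mean_le_arith_mean2_weighted a.toNNReal b.toNNReal u v
    (by rw [← Real.toNNReal_add ha.le hb.le, hab]; simp)
  rw [Real.coe_toNNReal _ ha.le, Real.coe_toNNReal _ hb.le] at this
  rw [← ENNReal.coe_rpow_of_nonneg _ ha.le, ← ENNReal.coe_rpow_of_nonneg _ hb.le]
  unfold ENNReal.ofReal
  exact_mod_cast this



lemma pl1_aux_ord {f : ℝ → ENNReal} (c : ENNReal) (hc : c ≠ ⊤) (hc0 : c ≠ 0) (hft : ∀ x, f x ≠ ⊤)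
    (fo : ∀ t, {x | t < f x}.OrdConnected) (t : ℝ) :
    {x | t < (f x * c⁻¹).toReal}.OrdConnected := by
  rcases lt_or_ge t 0 with h | h
  · have : {x | t < (f x * c⁻¹).toReal} = univ := by
      ext x; simp only [mem_ofPred_eq, mem_univ, iff_true]
      exact lt_of_lt_of_le h ENNReal.toReal_nonneg
    rw [this]; exact ordConnected_univ
  · have : {x | t < (f x * c⁻¹).toReal} = {x | ENNReal.ofReal t * c < f x} := by
      ext x; simp only [mem_ofPred_eq]
      rw [← ENNReal.ofReal_lt_iff_lt_toReal h (ENNReal.mul_ne_top (hft x) (ENNReal.inv_ne_top.2 hc0)),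
        ← div_eq_mul_inv, ENNReal.lt_div_iff_mul_lt (Or.inl hc0) (Or.inl hc)]
    rw [this]; exact fo _

lemma pl1_bdd {f g h : ℝ → ENNReal} {a b : ℝ} (ha : 0 < a) (hb : 0 < b) (hab : a + b = 1)
    (k : ENNReal) (hk : k ≠ ⊤) (fk : ∀ x, f x ≤ k) (gk : ∀ x, g x ≤ k) (hhk : ∀ x, h x ≤ k)
    (fo : ∀ t, {x | t < f x}.OrdConnected) (go : ∀ t, {x | t < g x}.OrdConnected)
    (ho : ∀ t, {x | t < h x}.OrdConnected)
    (hyp : ∀ x y, f x ^ a * g y ^ b ≤ h (a * x + b * y)) :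
    (∫⁻ x, f x) ^ a * (∫⁻ x, g x) ^ b ≤ ∫⁻ x, h x := by
  set F := ⨆ x, f x with hF
  set G := ⨆ x, g x with hG
  have Ft : F ≠ ⊤ := ne_top_of_le_ne_top hk (iSup_le fk)
  have Gt : G ≠ ⊤ := ne_top_of_le_ne_top hk (iSup_le gk)
  by_cases F0 : F = 0
  · have : ∀ x, f x = 0 := fun x => le_antisymm (F0 ▸ le_iSup f x) bot_le
    simp [this, ENNReal.zero_rpow_of_pos ha]
  by_cases G0 : G = 0
  · have : ∀ x, g x = 0 := fun x => le_antisymm (G0 ▸ le_iSup g x) bot_le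
    simp [this, ENNReal.zero_rpow_of_pos hb]
  have ft : ∀ x, f x ≠ ⊤ := fun x => ne_top_of_le_ne_top hk (fk x)
  have gt : ∀ x, g x ≠ ⊤ := fun x => ne_top_of_le_ne_top hk (gk x)
  have ht : ∀ x, h x ≠ ⊤ := fun x => ne_top_of_le_ne_top hk (hhk x)
  set C := F ^ a * G ^ b with hC
  have Fa0 : F ^ a ≠ 0 := by
    intro h; rw [ENNReal.rpow_eq_zero_iff] at h; rcases h with h | h
    · exact F0 h.1
    · exact Ft h.1
  have Gb0 : G ^ b ≠ 0 := by
    intro h; rw [ENNReal.rpow_eq_zero_iff] at h; rcases h with h | h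
    · exact G0 h.1
    · exact Gt h.1
  have Fat : F ^ a ≠ ⊤ := ENNReal.rpow_ne_top_of_nonneg ha.le Ft
  have Gbt : G ^ b ≠ ⊤ := ENNReal.rpow_ne_top_of_nonneg hb.le Gt
  have C0 : C ≠ 0 := mul_ne_zero Fa0 Gb0
  have Ct : C ≠ ⊤ := ENNReal.mul_ne_top Fat Gbt
  have sup_aux : ∀ (f : ℝ → ENNReal) (F : ENNReal), F = ⨆ x, f x → F ≠ ⊤ → F ≠ 0 →
      (∀ x, f x ≠ ⊤) → ∀ t : ℝ, t < 1 → ∃ x, t < (f x * F⁻¹).toReal := by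
    intro f F hF Ft F0 ft t ht
    rcases lt_or_ge t 0 with h | h
    · exact ⟨0, lt_of_lt_of_le h ENNReal.toReal_nonneg⟩
    · have : ENNReal.ofReal t * F < ⨆ x, f x := by
        rw [← hF]
        calc _ < 1 * F := by
              rw [ENNReal.mul_lt_mul_iff_left F0 Ft]
              rw [ENNReal.ofReal_lt_one]; exact ht
          _ = F := one_mul _
      obtain ⟨x, hx⟩ := lt_iSup_iff.1 this
      refine ⟨x, ?_⟩
      rwa [← ENNReal.ofReal_lt_iff_lt_toReal h (ENNReal.mul_ne_top (ft x) (ENNReal.inv_ne_top.2 F0)),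
        ← div_eq_mul_inv, ENNReal.lt_div_iff_mul_lt (Or.inl F0) (Or.inl Ft)]
  have le_aux : ∀ (f : ℝ → ENNReal) (F : ENNReal), F = ⨆ x, f x → ∀ x, (f x * F⁻¹).toReal ≤ 1 := by
    intro f F hF x
    refine ENNReal.toReal_le_of_le_ofReal zero_le_one ?_
    rw [ENNReal.ofReal_one, ← div_eq_mul_inv]
    exact ENNReal.div_le_of_le_mul (by rw [one_mul, hF]; exact le_iSup f x)
  have int_aux : ∀ (f : ℝ → ENNReal) (F : ENNReal), F ≠ 0 → (∀ x, f x ≠ ⊤) →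
      ∫⁻ x, ENNReal.ofReal (f x * F⁻¹).toReal = (∫⁻ x, f x) * F⁻¹ := by
    intro f F F0 ft
    rw [← lintegral_mul_const' _ _ (ENNReal.inv_ne_top.2 F0)]
    congr 1; ext x
    rw [ENNReal.ofReal_toReal (ENNReal.mul_ne_top (ft x) (ENNReal.inv_ne_top.2 F0))]
  have main := pl1_norm (f := fun x => (f x * F⁻¹).toReal) (g := fun x => (g x * G⁻¹).toReal)
    (h := fun x => (h x * C⁻¹).toReal) ha hb hab (fun _ => ENNReal.toReal_nonneg)
    (fun _ => ENNReal.toReal_nonneg) (fun _ => ENNReal.toReal_nonneg)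
    (le_aux f F hF) (le_aux g G hG) (sup_aux f F hF Ft F0 ft) (sup_aux g G hG Gt G0 gt)
    (pl1_aux_ord F Ft F0 ft fo) (pl1_aux_ord G Gt G0 gt go) (pl1_aux_ord C Ct C0 ht ho) ?_
  · rw [int_aux f F F0 ft, int_aux g G G0 gt, int_aux h C C0 ht] at main
    have := (ennreal_amgm ha hb hab _ _).trans main
    rw [ENNReal.mul_rpow_of_nonneg _ _ ha.le, ENNReal.mul_rpow_of_nonneg _ _ hb.le,
      ENNReal.inv_rpow, ENNReal.inv_rpow, mul_mul_mul_comm,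
      ← ENNReal.mul_inv (Or.inl Fa0) (Or.inl Fat), ← hC] at this
    calc _ = ((∫⁻ x, f x) ^ a * (∫⁻ x, g x) ^ b) * C⁻¹ * C := by
            rw [mul_assoc, ENNReal.inv_mul_cancel C0 Ct, mul_one]
      _ ≤ (∫⁻ x, h x) * C⁻¹ * C := by gcongr
      _ = _ := by rw [mul_assoc, ENNReal.inv_mul_cancel C0 Ct, mul_one]
  · intro x y
    rw [ENNReal.toReal_rpow, ENNReal.toReal_rpow, ← ENNReal.toReal_mul]
    refine ENNReal.toReal_mono (ENNReal.mul_ne_top (ht _) (ENNReal.inv_ne_top.2 C0)) ?_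
    rw [ENNReal.mul_rpow_of_nonneg _ _ ha.le, ENNReal.mul_rpow_of_nonneg _ _ hb.le,
      ENNReal.inv_rpow, ENNReal.inv_rpow, mul_mul_mul_comm,
      ← ENNReal.mul_inv (Or.inl Fa0) (Or.inl Fat), ← hC]
    gcongr
    exact hyp x y

lemma ord_min {f : ℝ → ENNReal} (fo : ∀ t, {x | t < f x}.OrdConnected) (k t : ENNReal) :
    {x | t < min (f x) k}.OrdConnected := by
  by_cases h : t < k
  · simpa [lt_min_iff, h] using fo t
  · simpa [h] using ordConnected_empty

lemma lintegral_min {f : ℝ → ENNReal} (fo : ∀ t, {x | t < f x}.OrdConnected) :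
    ∫⁻ x, f x = ⨆ k : ℕ, ∫⁻ x, min (f x) k := by
  rw [← lintegral_iSup]
  · congr 1; ext x
    apply le_antisymm
    · have := inf_iSup_eq (f x) (fun n : ℕ => (n : ENNReal))
      rw [ENNReal.iSup_natCast, inf_top_eq] at this
      exact this.le
    · exact iSup_le fun k => min_le_left _ _
  · intro k
    exact measurable_of_Ioi fun t => (ord_min fo k t).measurableSet
  · intro i j hij x
    dsimp
    gcongr

lemma pl1 {f g h : ℝ → ENNReal} {a b : ℝ} (ha : 0 < a) (hb : 0 < b) (hab : a + b = 1)
    (fo : ∀ t, {x | t < f x}.OrdConnected) (go : ∀ t, {x | t < g x}.OrdConnected)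
    (ho : ∀ t, {x | t < h x}.OrdConnected)
    (hyp : ∀ x y, f x ^ a * g y ^ b ≤ h (a * x + b * y)) :
    (∫⁻ x, f x) ^ a * (∫⁻ x, g x) ^ b ≤ ∫⁻ x, h x := by
  have key : ∀ k : ℕ, (∫⁻ x, min (f x) k) ^ a * (∫⁻ x, min (g x) k) ^ b ≤ ∫⁻ x, h x := by
    intro k
    refine le_trans (pl1_bdd (h := fun x => min (h x) k) ha hb hab k (ENNReal.natCast_ne_top k)
      (fun _ => min_le_right _ _) (fun _ => min_le_right _ _) (fun _ => min_le_right _ _)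
      (ord_min fo k) (ord_min go k) (ord_min ho k) ?_) (lintegral_mono fun x => min_le_left _ _)
    intro x y
    refine le_min (le_trans ?_ (hyp x y)) ?_
    · gcongr <;> exact min_le_left _ _
    · calc _ ≤ (k : ENNReal) ^ a * (k : ENNReal) ^ b := by gcongr <;> exact min_le_right _ _
        _ = k := by rw [← ENNReal.rpow_add_of_nonneg _ _ ha.le hb.le, hab, ENNReal.rpow_one]
  rw [lintegral_min fo, lintegral_min go]
  have e1 := (ENNReal.orderIsoRpow a ha).map_iSup (fun k : ℕ => ∫⁻ x, min (f x) k)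
  have e2 := (ENNReal.orderIsoRpow b hb).map_iSup (fun k : ℕ => ∫⁻ x, min (g x) k)
  simp only [ENNReal.orderIsoRpow_apply] at e1 e2
  rw [e1, e2, ENNReal.iSup_mul]
  refine iSup_le fun i => ?_
  rw [ENNReal.mul_iSup]
  refine iSup_le fun j => le_trans ?_ (key (max i j))
  gcongr <;> simp



/-- log-concavity, `ENNReal` version -/
def LC {E : Type*} [AddCommGroup E] [Module ℝ E] (u : E → ENNReal) : Prop :=
  ∀ a b : ℝ, 0 < a → 0 < b → a + b = 1 → ∀ x y, u x ^ a * u y ^ b ≤ u (a • x + b • y)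

lemma LC.convex {E : Type*} [AddCommGroup E] [Module ℝ E] {u : E → ENNReal} (hu : LC u)
    (t : ENNReal) : Convex ℝ {x | t < u x} := by
  rw [convex_iff_forall_pos]
  intro x hx y hy a b ha hb hab
  have hm : t < min (u x) (u y) := lt_min hx hy
  refine lt_of_lt_of_le hm (le_trans ?_ (hu a b ha hb hab x y))
  calc min (u x) (u y) = min (u x) (u y) ^ a * min (u x) (u y) ^ b := by
        rw [← ENNReal.rpow_add_of_nonneg _ _ ha.le hb.le, hab, ENNReal.rpow_one]
    _ ≤ _ := by
      gcongr
      · exact min_le_left _ _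
      · exact min_le_right _ _

lemma aemeas_of_convex {E : Type*} [NormedAddCommGroup E] [NormedSpace ℝ E] [FiniteDimensional ℝ E]
    [MeasurableSpace E] [BorelSpace E] (μ : Measure E) [μ.IsAddHaarMeasure]
    {u : E → ENNReal} (hu : ∀ t, Convex ℝ {x | t < u x}) : AEMeasurable u μ := by
  have : NullMeasurable u μ := by
    have h := @measurable_of_Ioi ENNReal (NullMeasurableSpace E μ) _ _ _ _ _ _ _ u
      (fun t => (hu t).nullMeasurableSet μ)
    exact h
  exact this.aemeasurable

lemma lintegral_cons {n : ℕ} (u : (Fin (n + 1) → ℝ) → ENNReal) (hu : AEMeasurable u volume) :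
    ∫⁻ x, u x = ∫⁻ t : ℝ, ∫⁻ z : Fin n → ℝ, u (Fin.cons t z) := by
  have mp := (volume_preserving_piFinSuccAbove (fun _ : Fin (n + 1) => ℝ) 0).symm
  rw [← mp.lintegral_comp_emb (MeasurableEquiv.measurableEmbedding _)]
  have := lintegral_prod (μ := (volume : Measure ℝ)) (ν := (volume : Measure (Fin n → ℝ)))
    (fun p => u ((MeasurableEquiv.piFinSuccAbove (fun _ : Fin (n + 1) => ℝ) 0).symm p))
    (hu.comp_quasiMeasurePreserving mp.quasiMeasurePreserving)
  rw [← Measure.volume_eq_prod] at this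
  refine this.trans ?_
  simp [MeasurableEquiv.piFinSuccAbove, Fin.insertNthEquiv]

theorem prekopa (n : ℕ) : ∀ {V : Type} [AddCommGroup V] [Module ℝ V] (g : V × (Fin n → ℝ) → ENNReal),
    LC g → LC (fun v => ∫⁻ x, g (v, x)) := by
  induction n with
  | zero =>
    intro V _ _ g hg a b ha hb hab v w
    have h0 : (volume : Measure (Fin 0 → ℝ)) = Measure.dirac 0 := Measure.volume_pi_eq_dirac 0
    simp only [h0, lintegral_dirac]
    have := hg a b ha hb hab (v, 0) (w, 0)
    simpa using this
  | succ n ih =>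
    intro V _ _ g hg
    have hG : LC (fun p : (V × ℝ) × (Fin n → ℝ) => g (p.1.1, Fin.cons p.1.2 p.2)) := by
      intro a b ha hb hab p q
      refine le_trans (hg a b ha hb hab _ _) (le_of_eq ?_)
      congr 1
      refine Prod.ext rfl ?_
      ext i
      refine Fin.cases ?_ (fun i => ?_) i <;> simp
    have hI := ih _ hG
    have hslice : ∀ v, LC (fun x => g (v, x)) := by
      intro v a b ha hb hab x y
      refine le_trans (hg a b ha hb hab _ _) (le_of_eq ?_)
      congr 1
      refine Prod.ext ?_ rfl
      simp [← add_smul, hab]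
    have hslice2 : ∀ v, LC (fun t : ℝ => ∫⁻ z, g (v, Fin.cons t z)) := by
      intro v a b ha hb hab x y
      refine le_trans (hI a b ha hb hab (v, x) (v, y)) (le_of_eq ?_)
      simp [← add_smul, hab]
    have e : ∀ v, ∫⁻ x, g (v, x) = ∫⁻ t : ℝ, ∫⁻ z : Fin n → ℝ, g (v, Fin.cons t z) := fun v =>
      lintegral_cons (fun x => g (v, x)) (aemeas_of_convex _ (hslice v).convex)
    intro a b ha hb hab v w
    simp only [e]
    refine pl1 ha hb hab (fun t => ((hslice2 v).convex t).ordConnected)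
      (fun t => ((hslice2 w).convex t).ordConnected)
      (fun t => ((hslice2 _).convex t).ordConnected) ?_
    intro x y
    exact hI a b ha hb hab (v, x) (w, y)



/-- four point inequality for the tail function -/
def FP {Ω : Type*} [MeasurableSpace Ω] (μ : Measure Ω) (T : Ω → ℝ) : Prop :=
  ∀ s x y : ℝ, 0 ≤ x → 0 ≤ y →
    μ {ω | s < T ω} * μ {ω | s + (x + y) < T ω} ≤ μ {ω | s + x < T ω} * μ {ω | s + y < T ω}

lemma LC.four {S : ℝ → ENNReal} (hS : LC S) (s x y : ℝ) (hx : 0 ≤ x) (hy : 0 ≤ y) :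
    S s * S (s + (x + y)) ≤ S (s + x) * S (s + y) := by
  rcases hx.eq_or_lt with rfl | hx
  · simp
  rcases hy.eq_or_lt with rfl | hy
  · simp [mul_comm]
  have hxy : 0 < x + y := by positivity
  set a := y / (x + y) with ha
  set b := x / (x + y) with hb
  have a0 : 0 < a := by positivity
  have b0 : 0 < b := by positivity
  have hab : a + b = 1 := by rw [ha, hb]; field_simp; ring
  have e1 : a • s + b • (s + (x + y)) = s + x := by
    rw [ha, hb, smul_eq_mul, smul_eq_mul]; field_simp; ring
  have e2 : b • s + a • (s + (x + y)) = s + y := by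
    rw [ha, hb, smul_eq_mul, smul_eq_mul]; field_simp; ring
  have h1 := hS a b a0 b0 hab s (s + (x + y))
  have h2 := hS b a b0 a0 (by linarith) s (s + (x + y))
  rw [e1] at h1; rw [e2] at h2
  calc S s * S (s + (x + y)) = S s ^ (a + b) * S (s + (x + y)) ^ (b + a) := by
        rw [add_comm b a, hab, ENNReal.rpow_one, ENNReal.rpow_one]
    _ = (S s ^ a * S (s + (x + y)) ^ b) * (S s ^ b * S (s + (x + y)) ^ a) := by
        rw [ENNReal.rpow_add_of_nonneg _ _ a0.le b0.le, ENNReal.rpow_add_of_nonneg _ _ b0.le a0.le]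
        ring
    _ ≤ _ := by gcongr

section
variable {Ω : Type*} [MeasurableSpace Ω] (μ : Measure Ω) [IsProbabilityMeasure μ] {T : Ω → ℝ}

lemma tail_meas (T : Ω → ℝ) : Measurable fun t => μ {ω | t < T ω} :=
  Antitone.measurable fun s t hst => measure_mono fun x hx => lt_of_le_of_lt hst hx

lemma lint_P1 (hT : Measurable T) (s : ℝ) :
    ∫⁻ ω, ENNReal.ofReal (max (T ω - s) 0) ∂μ = ∫⁻ t in Ioi 0, μ {ω | s + t < T ω} := by
  rw [lintegral_eq_lintegral_meas_lt μ (f := fun ω => max (T ω - s) 0)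
    (ae_of_all _ fun ω => le_max_right _ _) (by fun_prop)]
  refine setLIntegral_congr_fun measurableSet_Ioi fun t ht => ?_
  have ht' : 0 < t := ht
  congr 1; ext ω
  simp only [mem_ofPred_eq, lt_max_iff, not_lt.2 ht'.le, or_false]
  constructor <;> intro h <;> linarith

lemma lint_P2 (hT : Measurable T) (s : ℝ) :
    ∫⁻ ω, ENNReal.ofReal ((max (T ω - s) 0) ^ 2) ∂μ
      = 2 * ∫⁻ t in Ioi 0, μ {ω | s + t < T ω} * ENNReal.ofReal t := by
  have := lintegral_rpow_eq_lintegral_meas_lt_mul (μ := μ) (f := fun ω => max (T ω - s) 0)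
    (ae_of_all _ fun ω => le_max_right _ _) (by fun_prop) (p := 2) (by norm_num)
  simp only [Real.rpow_two, ENNReal.ofReal_ofNat] at this
  rw [this]
  congr 1
  refine setLIntegral_congr_fun measurableSet_Ioi fun t ht => ?_
  have ht' : 0 < t := ht
  congr 1
  · congr 1; ext ω
    simp only [mem_ofPred_eq, lt_max_iff, not_lt.2 ht'.le, or_false]
    constructor <;> intro h <;> linarith
  · norm_num

lemma double_int {S : ℝ → ENNReal} (hS : Measurable S) :
    ∫⁻ x in Ioi (0:ℝ), ∫⁻ y in Ioi (0:ℝ), S (x + y) = ∫⁻ t in Ioi (0:ℝ), S t * ENNReal.ofReal t := by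
  have e1 : ∀ x : ℝ, ∫⁻ y in Ioi (0:ℝ), S (x + y) = ∫⁻ t, (Ioi x).indicator S t := by
    intro x
    rw [← lintegral_indicator measurableSet_Ioi,
      ← lintegral_add_left_eq_self ((Ioi x).indicator S) x]
    congr 1; ext y
    by_cases h : 0 < y <;> simp [indicator, h]
  simp only [e1]
  rw [← lintegral_indicator measurableSet_Ioi]
  have e2 : ∀ x : ℝ, (Ioi (0:ℝ)).indicator (fun x => ∫⁻ t, (Ioi x).indicator S t) x =
      ∫⁻ t, ({p : ℝ × ℝ | 0 < p.1 ∧ p.1 < p.2}.indicator (fun p => S p.2)) (x, t) := by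
    intro x
    by_cases h : 0 < x
    · simp [indicator, h]
    · simp [indicator, h]
  simp only [e2]
  have hm : MeasurableSet {p : ℝ × ℝ | 0 < p.1 ∧ p.1 < p.2} :=
    (measurableSet_lt measurable_const measurable_fst).inter
      (measurableSet_lt measurable_fst measurable_snd)
  rw [lintegral_lintegral_swap
    (f := fun x t => ({p : ℝ × ℝ | 0 < p.1 ∧ p.1 < p.2}.indicator (fun p => S p.2)) (x, t))
    (((hS.comp measurable_snd).indicator hm).aemeasurable)]
  rw [← lintegral_indicator measurableSet_Ioi]
  congr 1; ext t
  have : ∀ x, ({p : ℝ × ℝ | 0 < p.1 ∧ p.1 < p.2}.indicator (fun p => S p.2)) (x, t) =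
      (Ioo 0 t).indicator (fun _ => S t) x := by
    intro x; simp [indicator]
  simp only [this]
  rw [lintegral_indicator measurableSet_Ioo, setLIntegral_const, Real.volume_Ioo, sub_zero]
  by_cases h : 0 < t
  · simp [indicator, h]
  · simp [indicator, h, ENNReal.ofReal_of_nonpos (not_lt.1 h)]

lemma FP.moment (hfp : FP μ T) (hT : Measurable T) (s : ℝ) :
    μ {ω | s < T ω} * ∫⁻ ω, ENNReal.ofReal ((max (T ω - s) 0) ^ 2) ∂μ ≤
      2 * (∫⁻ ω, ENNReal.ofReal (max (T ω - s) 0) ∂μ) ^ 2 := by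
  rw [lint_P1 μ hT, lint_P2 μ hT, mul_left_comm]
  gcongr
  have hS : Measurable fun t => μ {ω | s + t < T ω} := (tail_meas μ T).comp (measurable_const_add s)
  rw [← double_int hS, ← lintegral_const_mul' _ _ (measure_ne_top _ _), sq,
    ← lintegral_const_mul _ hS]
  refine lintegral_mono_ae ?_
  filter_upwards [ae_restrict_mem measurableSet_Ioi] with x hx
  rw [← lintegral_const_mul' _ _ (measure_ne_top _ _), ← lintegral_mul_const _ hS]
  refine lintegral_mono_ae ?_
  filter_upwards [ae_restrict_mem measurableSet_Ioi] with y hy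
  rw [mul_comm (μ {ω | s + y < T ω})]
  exact hfp s x y (le_of_lt hx) (le_of_lt hy)

lemma FP.shift (hfp : FP μ T) (hT : Measurable T) (h s : ℝ) (hs : 0 ≤ s) :
    μ {ω | h - s < T ω} * ∫⁻ ω, ENNReal.ofReal ((max (T ω - h) 0) ^ 2) ∂μ ≤
      μ {ω | h < T ω} * ∫⁻ ω, ENNReal.ofReal ((max (T ω - (h - s)) 0) ^ 2) ∂μ := by
  rw [lint_P2 μ hT, lint_P2 μ hT, mul_left_comm, mul_left_comm (μ {ω | h < T ω})]
  gcongr 2 * ?_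
  rw [← lintegral_const_mul' _ _ (measure_ne_top _ _), ← lintegral_const_mul' _ _ (measure_ne_top _ _)]
  refine lintegral_mono_ae ?_
  filter_upwards [ae_restrict_mem measurableSet_Ioi] with t ht
  rw [← mul_assoc, ← mul_assoc]
  gcongr ?_ * _
  have := hfp (h - s) s t hs (le_of_lt ht)
  simpa [← add_assoc] using this

lemma int_P1 (i1 : Integrable T μ) (s : ℝ) : Integrable (fun ω => max (T ω - s) 0) μ :=
  (i1.sub (integrable_const s)).pos_part

lemma int_sq (i1 : Integrable T μ)
    (i2 : Integrable (fun ω => T ω ^ 2) μ) (s : ℝ) : Integrable (fun ω => (T ω - s) ^ 2) μ := by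
  have : (fun ω => (T ω - s) ^ 2) = fun ω => T ω ^ 2 - 2 * s * T ω + s ^ 2 := by
    ext ω; ring
  rw [this]
  exact (i2.sub (i1.const_mul _)).add (integrable_const _)

lemma int_P2 (hT : Measurable T) (i1 : Integrable T μ)
    (i2 : Integrable (fun ω => T ω ^ 2) μ) (s : ℝ) :
    Integrable (fun ω => (max (T ω - s) 0) ^ 2) μ := by
  refine (int_sq μ i1 i2 s).mono' (by fun_prop) (ae_of_all _ fun ω => ?_)
  rw [Real.norm_of_nonneg (by positivity)]
  rcases le_total (T ω - s) 0 with h | h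
  · rw [max_eq_right h]; nlinarith
  · rw [max_eq_left h]

lemma p1_nonneg (s : ℝ) : 0 ≤ ∫ ω, max (T ω - s) 0 ∂μ :=
  integral_nonneg fun ω => le_max_right _ _

lemma FP.moment_real (hfp : FP μ T) (hT : Measurable T) (i1 : Integrable T μ)
    (i2 : Integrable (fun ω => T ω ^ 2) μ) (s : ℝ) :
    μ.real {ω | s < T ω} * ∫ ω, (max (T ω - s) 0) ^ 2 ∂μ ≤ 2 * (∫ ω, max (T ω - s) 0 ∂μ) ^ 2 := by
  have := hfp.moment μ hT s
  rw [← ofReal_integral_eq_lintegral_ofReal (int_P2 μ hT i1 i2 s) (ae_of_all _ fun ω => by positivity),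
    ← ofReal_integral_eq_lintegral_ofReal (int_P1 μ i1 s) (ae_of_all _ fun ω => le_max_right _ _)]
    at this
  have h2 := ENNReal.toReal_mono (by finiteness) this
  rwa [ENNReal.toReal_mul, ENNReal.toReal_mul, ENNReal.toReal_pow,
    ENNReal.toReal_ofReal (integral_nonneg fun ω => by positivity),
    ENNReal.toReal_ofReal (p1_nonneg μ s)] at h2

lemma FP.shift_real (hfp : FP μ T) (hT : Measurable T) (i1 : Integrable T μ)
    (i2 : Integrable (fun ω => T ω ^ 2) μ) (h s : ℝ) (hs : 0 ≤ s) :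
    μ.real {ω | h - s < T ω} * ∫ ω, (max (T ω - h) 0) ^ 2 ∂μ ≤
      μ.real {ω | h < T ω} * ∫ ω, (max (T ω - (h - s)) 0) ^ 2 ∂μ := by
  have := hfp.shift μ hT h s hs
  rw [← ofReal_integral_eq_lintegral_ofReal (int_P2 μ hT i1 i2 _) (ae_of_all _ fun ω => by positivity),
    ← ofReal_integral_eq_lintegral_ofReal (int_P2 μ hT i1 i2 _) (ae_of_all _ fun ω => by positivity)]
    at this
  have h2 := ENNReal.toReal_mono (by finiteness) this
  rwa [ENNReal.toReal_mul, ENNReal.toReal_mul, 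
    ENNReal.toReal_ofReal (integral_nonneg fun ω => by positivity),
    ENNReal.toReal_ofReal (integral_nonneg fun ω => by positivity)] at h2

/-- one-dimensional core estimate -/
lemma tail_core (hT : Measurable T) (hfp : FP μ T) (hfp' : FP μ (fun ω => - T ω))
    (i1 : Integrable T μ) (i2 : Integrable (fun ω => T ω ^ 2) μ)
    (e1 : ∫ ω, T ω ∂μ = 0) (e2 : ∫ ω, T ω ^ 2 ∂μ = 1) :
    1 / 100 < μ.real {ω | (9 / 17 : ℝ) ≤ T ω} := by
  by_contra hcon
  push Not at hcon
  set h : ℝ := 9 / 17 with hh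
  set δ := μ.real {ω | h ≤ T ω} with hδ
  have i1' : Integrable (fun ω => - T ω) μ := i1.neg
  have i2' : Integrable (fun ω => (- T ω) ^ 2) μ := by simpa using i2
  set A1 := ∫ ω, max (- T ω - (-h)) 0 ∂μ with hA1
  set A2 := ∫ ω, (max (- T ω - (-h)) 0) ^ 2 ∂μ with hA2
  set B1 := ∫ ω, max (T ω - h) 0 ∂μ with hB1
  set B2 := ∫ ω, (max (T ω - h) 0) ^ 2 ∂μ with hB2
  have intA1 := int_P1 μ i1' (-h)
  have hT' : Measurable fun ω => - T ω := hT.neg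
  have intA2 := int_P2 μ hT' i1' i2' (-h)
  have intB1 := int_P1 μ i1 h
  have intB2 := int_P2 μ hT i1 i2 h
  have r1 : A1 - B1 = h := by
    rw [hA1, hB1, ← integral_sub intA1 intB1]
    have : ∀ ω, max (- T ω - (-h)) 0 - max (T ω - h) 0 = h - T ω := by
      intro ω
      rcases le_total (T ω) h with h' | h'
      · rw [max_eq_left (by linarith), max_eq_right (by linarith)]; ring
      · rw [max_eq_right (by linarith), max_eq_left (by linarith)]; ring
    simp only [this]
    rw [integral_sub (integrable_const _) i1, e1]; simp
  have sqint : ∀ s : ℝ, ∫ ω, (T ω - s) ^ 2 ∂μ = 1 + s ^ 2 := by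
    intro s
    have : (fun ω => (T ω - s) ^ 2) = fun ω => T ω ^ 2 - 2 * s * T ω + s ^ 2 := by
      ext ω; ring
    have i3 : Integrable (fun ω => T ω ^ 2 - 2 * s * T ω) μ := i2.sub (i1.const_mul _)
    rw [this, integral_add i3 (integrable_const _),
      integral_sub i2 (i1.const_mul _), integral_const_mul, e1, e2]
    simp
  have r2 : A2 + B2 = 1 + h ^ 2 := by
    rw [hA2, hB2, ← integral_add intA2 intB2, ← sqint]
    congr 1; ext ω
    rcases le_total (T ω) h with h' | h'
    · rw [max_eq_left (by linarith), max_eq_right (by linarith)]; ring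
    · rw [max_eq_right (by linarith), max_eq_left (by linarith)]; ring
  have mset : MeasurableSet {ω | h ≤ T ω} := measurableSet_le measurable_const hT
  have r3 : (1 - δ) * A2 ≤ 2 * A1 ^ 2 := by
    have := hfp'.moment_real μ hT.neg i1' i2' (-h)
    have e : {ω | -h < - T ω} = {ω | h ≤ T ω}ᶜ := by
      ext ω; simp
    rw [e, probReal_compl_eq_one_sub mset] at this
    exact this
  have r4 : 3 / 4 * B2 ≤ δ * 5 := by
    have := hfp.shift_real μ hT i1 i2 h (h + 2) (by positivity)
    have e : h - (h + 2) = -2 := by ring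
    rw [e] at this
    have c1 : 3 / 4 ≤ μ.real {ω | -2 < T ω} := by
      have m2 : MeasurableSet {ω | -2 < T ω} := measurableSet_lt measurable_const hT
      have e' := probReal_compl_eq_one_sub (μ := μ) m2
      have : μ.real {ω | -2 < T ω}ᶜ * 4 ≤ 1 := by
        rw [← e2, ← integral_indicator_one m2.compl, ← integral_mul_const]
        refine integral_mono ?_ i2 fun ω => ?_
        · exact (integrable_indicator_iff m2.compl).2 (integrable_const _).integrableOn |>.mul_const _
        · by_cases hω : -2 < T ω
          · simp [indicator, hω]; positivity
          · simp [indicator, hω]; nlinarith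
      linarith
    have c2 : ∫ ω, (max (T ω - (-2)) 0) ^ 2 ∂μ ≤ 5 := by
      have : (5 : ℝ) = 1 + (-2) ^ 2 := by norm_num
      rw [this, ← sqint]
      refine integral_mono (int_P2 μ hT i1 i2 _) (int_sq μ i1 i2 _) fun ω => ?_
      dsimp only
      rcases le_total (T ω - (-2)) 0 with h | h
      · rw [max_eq_right h]; nlinarith
      · rw [max_eq_left h]
    have c3 : μ.real {ω | h < T ω} ≤ δ := measureReal_mono fun ω (hω : h < T ω) => le_of_lt hω
    have c4 : 0 ≤ B2 := integral_nonneg fun ω => by positivity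
    calc 3 / 4 * B2 ≤ μ.real {ω | -2 < T ω} * B2 := by gcongr
      _ ≤ _ := this
      _ ≤ δ * 5 := by gcongr
  have r5 : B1 ≤ δ + B2 * (1 / 4) := by
    rw [hB1, hB2, hδ, ← integral_indicator_one mset, ← integral_mul_const, ← integral_add]
    · refine integral_mono intB1 ?_ fun ω => ?_
      · exact ((integrable_indicator_iff mset).2 (integrable_const _).integrableOn).add
          (intB2.mul_const _)
      · by_cases hω : h ≤ T ω
        · simp only [indicator, mem_ofPred_eq, hω, if_true, Pi.one_apply]
          nlinarith [sq_nonneg (max (T ω - h) 0 - 2)]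
        · have : T ω - h ≤ 0 := by linarith
          simp only [indicator, mem_ofPred_eq, hω, if_false]
          rw [max_eq_right this]; norm_num
    · exact (integrable_indicator_iff mset).2 (integrable_const _).integrableOn
    · exact intB2.mul_const _
  have δ0 : 0 ≤ δ := measureReal_nonneg
  have A20 : 0 ≤ A2 := integral_nonneg fun ω => by positivity
  have A10 : 0 ≤ A1 := integral_nonneg fun ω => le_max_right _ _
  have hB2' : B2 ≤ 1 / 15 := by linarith
  have hA1' : A1 ≤ 0.5562 := by rw [hh] at r1; linarith
  have hA1sq : A1 ^ 2 ≤ 0.5562 ^ 2 := by gcongr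
  have : (99 / 100) * A2 ≤ (1 - δ) * A2 := by gcongr; linarith
  rw [hh] at r2
  norm_num at r2 hA1sq
  linarith

end


lemma IsLogConcaveFn.lc {n : ℕ} {f : Euc n → ℝ} (hf : IsLogConcaveFn f) :
    LC (fun x => ENNReal.ofReal (f x)) := by
  intro a b ha hb hab x y
  rw [ENNReal.ofReal_rpow_of_nonneg (hf.1 x) ha.le, ENNReal.ofReal_rpow_of_nonneg (hf.1 y) hb.le,
    ← ENNReal.ofReal_mul (Real.rpow_nonneg (hf.1 x) a)]
  have hb' : b = 1 - a := by linarith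
  subst hb'
  exact ENNReal.ofReal_le_ofReal (hf.2 x y a ha.le (by linarith))

lemma IsLogConcaveFn.convex_lt {n : ℕ} {f : Euc n → ℝ} (hf : IsLogConcaveFn f) (t : ℝ) :
    Convex ℝ {x | t < f x} := by
  rcases lt_or_ge t 0 with h | h
  · have : {x | t < f x} = univ := by
      ext x; simp only [mem_ofPred_eq, mem_univ, iff_true]; exact lt_of_lt_of_le h (hf.1 x)
    rw [this]; exact convex_univ
  · have : {x | t < f x} = {x | ENNReal.ofReal t < ENNReal.ofReal (f x)} := by
      ext x; simp only [mem_ofPred_eq]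
      rw [ENNReal.ofReal_lt_ofReal_iff_of_nonneg h]
    rw [this]; exact hf.lc.convex _

lemma IsLogConcaveFn.convex_le {n : ℕ} {f : Euc n → ℝ} (hf : IsLogConcaveFn f) (t : ℝ) :
    Convex ℝ {x | t ≤ f x} := by
  have : {x | t ≤ f x} = ⋂ s : Iio t, {x | (s : ℝ) < f x} := by
    ext x; simp only [mem_ofPred_eq, mem_iInter, Subtype.forall, mem_Iio]
    exact ⟨fun h s hs => lt_of_lt_of_le hs h, fun h => le_of_forall_lt h⟩
  rw [this]; exact convex_iInter fun s => hf.convex_lt _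

lemma fp_inner {n : ℕ} {f : Euc n → ℝ} {μ : Measure (Euc n)} (hf : IsLogConcaveFn f)
    (hμ : μ = volume.withDensity (fun x => ENNReal.ofReal (f x))) (u : Euc n) :
    FP μ (fun x => inner ℝ u x) := by
  classical
  set g : ℝ × (Fin n → ℝ) → ENNReal := fun p =>
    if p.1 < inner ℝ u (WithLp.toLp 2 p.2 : Euc n) then ENNReal.ofReal (f (WithLp.toLp 2 p.2)) else 0
    with hgdef
  have hg : LC g := by
    intro a b ha hb hab p q
    by_cases hp : p.1 < inner ℝ u (WithLp.toLp 2 p.2 : Euc n)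
    · by_cases hq : q.1 < inner ℝ u (WithLp.toLp 2 q.2 : Euc n)
      · have h3 : (a • p + b • q).1 < inner ℝ u (WithLp.toLp 2 (a • p + b • q).2 : Euc n) := by
          simp only [Prod.fst_add, Prod.smul_fst, Prod.snd_add, Prod.smul_snd, WithLp.toLp_add,
            WithLp.toLp_smul, inner_add_right, inner_smul_right, smul_eq_mul]
          gcongr
        simp only [hgdef, hp, hq, h3, if_true]
        exact hf.lc a b ha hb hab _ _
      · simp [hgdef, hq, ENNReal.zero_rpow_of_pos hb]
    · simp [hgdef, hp, ENNReal.zero_rpow_of_pos ha]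
  have hS := prekopa n g hg
  have e : ∀ t, μ {x | t < inner ℝ u x} = ∫⁻ x, g (t, x) := by
    intro t
    have ms : MeasurableSet {x : Euc n | t < inner ℝ u x} :=
      measurableSet_lt measurable_const (by fun_prop)
    rw [hμ, withDensity_apply _ ms, ← lintegral_indicator ms,
      ← (PiLp.volume_preserving_toLp (Fin n)).lintegral_comp_emb
        (MeasurableEquiv.toLp 2 (Fin n → ℝ)).measurableEmbedding]
    congr 1
  intro s x y hx hy
  simp only [e]
  exact hS.four s x y hx hy

lemma lintegral_affine {n : ℕ} (g : Euc n → ENNReal) (c : ℝ) (hc : 0 < c) (v : Euc n) :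
    ∫⁻ x, g (c⁻¹ • x + v) = ENNReal.ofReal (c ^ n) * ∫⁻ x, g x := by
  have h1 : ∫⁻ x, g (c⁻¹ • x + v) = ∫⁻ y, g (y + v) ∂(Measure.map (fun x => c⁻¹ • x) volume) := by
    have := lintegral_map_equiv (μ := (volume : Measure (Euc n))) (fun y => g (y + v))
      (MeasurableEquiv.smul₀ (c⁻¹) (inv_ne_zero hc.ne'))
    exact this.symm
  rw [h1, Measure.map_addHaar_smul _ (inv_ne_zero hc.ne'), lintegral_smul_measure,
    lintegral_add_right_eq_self]
  simp [abs_of_pos hc]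

lemma low_tail {n : ℕ} (hn : 1 ≤ n) {f : Euc n → ℝ} {μ : Measure (Euc n)} [IsProbabilityMeasure μ]
    (hf : IsLogConcaveFn f)
    (hμ : μ = volume.withDensity (fun x => ENNReal.ofReal (f x))) (x0 : Euc n) (h0 : 0 < f x0) :
    μ.real (interior {x | Real.exp (-(8 * n)) * f x0 ≤ f x})ᶜ ≤ 1 / 100 := by
  set L := {x | Real.exp (-(8 * n)) * f x0 ≤ f x} with hL
  have hLc : Convex ℝ L := hf.convex_le _
  have hfr : ∀ᵐ x ∂(volume : Measure (Euc n)), x ∉ frontier L :=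
    compl_mem_ae_iff.2 (by simpa using hLc.addHaar_frontier volume) 
  have tot : ∫⁻ x, ENNReal.ofReal (f x) = 1 := by
    have := measure_univ (μ := μ)
    rw [hμ, withDensity_apply _ MeasurableSet.univ, Measure.restrict_univ] at this
    exact this
  have hle : μ (interior L)ᶜ ≤ ENNReal.ofReal (1 / 100) := by
    rw [hμ, withDensity_apply _ isOpen_interior.measurableSet.compl]
    calc _ ≤ ∫⁻ x in (interior L)ᶜ, ENNReal.ofReal (Real.exp (-(7 * n))) *
          ENNReal.ofReal (f ((8:ℝ)⁻¹ • x + (7 / 8 : ℝ) • x0)) := by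
          refine setLIntegral_mono_ae' isOpen_interior.measurableSet.compl ?_
          filter_upwards [hfr] with x hx hxi
          have hxL : x ∉ L := by
            intro h
            exact hx ⟨subset_closure h, hxi⟩
          rw [← ENNReal.ofReal_mul (Real.exp_pos _).le]
          apply ENNReal.ofReal_le_ofReal
          have hxL' : f x < Real.exp (-(8 * n)) * f x0 := not_le.1 hxL
          have key := hf.2 x x0 (8⁻¹) (by norm_num) (by norm_num)
          norm_num at key
          rcases (hf.1 x).eq_or_lt with hz | hpos
          · rw [← hz]; exact mul_nonneg (Real.exp_pos _).le (hf.1 _)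
          have k2 : f x ^ (7 / 8 : ℝ) ≤ Real.exp (-(7 * n)) * f x0 ^ (7 / 8 : ℝ) := by
            calc _ ≤ (Real.exp (-(8 * n)) * f x0) ^ (7 / 8 : ℝ) := by gcongr
              _ = _ := by
                rw [Real.mul_rpow (Real.exp_pos _).le h0.le, ← Real.exp_mul]
                congr 2; ring
          calc f x = f x ^ (1 / 8 : ℝ) * f x ^ (7 / 8 : ℝ) := by
                rw [← Real.rpow_add hpos]; norm_num
            _ ≤ f x ^ (1 / 8 : ℝ) * (Real.exp (-(7 * n)) * f x0 ^ (7 / 8 : ℝ)) := by gcongr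
            _ = Real.exp (-(7 * n)) * (f x ^ (1 / 8 : ℝ) * f x0 ^ (7 / 8 : ℝ)) := by ring
            _ ≤ _ := by
              gcongr
              have e8 : (8:ℝ)⁻¹ = 1 / 8 := by norm_num
              rw [e8]
              exact key
      _ ≤ ∫⁻ x, ENNReal.ofReal (Real.exp (-(7 * n))) *
          ENNReal.ofReal (f ((8:ℝ)⁻¹ • x + (7 / 8 : ℝ) • x0)) := setLIntegral_le_lintegral _ _
      _ = ENNReal.ofReal (Real.exp (-(7 * n))) * ENNReal.ofReal (8 ^ n) := by
          rw [lintegral_const_mul' _ _ ENNReal.ofReal_ne_top,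
            lintegral_affine (fun x => ENNReal.ofReal (f x)) 8 (by norm_num), tot, mul_one]
      _ = ENNReal.ofReal ((8 * Real.exp (-7)) ^ n) := by
          rw [← ENNReal.ofReal_mul (Real.exp_pos _).le, mul_pow, ← Real.exp_nat_mul, mul_comm]
          congr 3; ring
      _ ≤ _ := by
          apply ENNReal.ofReal_le_ofReal
          have h7 : Real.exp (-7) ≤ 1 / 800 := by
            rw [Real.exp_neg, ← one_div]
            apply one_div_le_one_div_of_le (by norm_num)
            have := Real.exp_one_gt_d9
            calc (800 : ℝ) ≤ 2.7 ^ 7 := by norm_num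
              _ ≤ Real.exp 1 ^ 7 := by gcongr; linarith
              _ = Real.exp 7 := by rw [← Real.exp_nat_mul]; norm_num
          calc (8 * Real.exp (-7)) ^ n ≤ 8 * Real.exp (-7) :=
                pow_le_of_le_one (by positivity) (by linarith) (by omega)
            _ ≤ _ := by linarith
  exact ENNReal.toReal_le_of_le_ofReal (by norm_num) hle


lemma iso_coord {n : ℕ} {μ : Measure (Euc n)} [IsProbabilityMeasure μ]
    (hiso : ∀ i j : Fin n, ∫ x, x i * x j ∂μ = if i = j then 1 else 0) (i : Fin n) :
    MemLp (fun x : Euc n => x i) 2 μ := by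
  rw [memLp_two_iff_integrable_sq (by fun_prop)]
  by_contra h
  have h1 := hiso i i
  simp only [if_true, ← pow_two] at h1
  rw [integral_undef h] at h1
  norm_num at h1

lemma iso_inner {n : ℕ} {μ : Measure (Euc n)} [IsProbabilityMeasure μ]
    (hcent : ∫ x, x ∂μ = 0)
    (hiso : ∀ i j : Fin n, ∫ x, x i * x j ∂μ = if i = j then 1 else 0) (u : Euc n) :
    Integrable (fun x => inner ℝ u x) μ ∧ Integrable (fun x => (inner ℝ u x) ^ 2) μ ∧
    ∫ x, inner ℝ u x ∂μ = 0 ∧ ∫ x, (inner ℝ u x) ^ 2 ∂μ = ‖u‖ ^ 2 := by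
  have hc := iso_coord hiso
  have hid : Integrable (fun x : Euc n => x) μ := by
    exact Integrable.of_eval_piLp fun i => (hc i).integrable (by norm_num)
  have hm : MemLp (fun x : Euc n => inner ℝ u x) 2 μ := by
    have : (fun x : Euc n => inner ℝ u x) = fun x => ∑ i, x i * u i := by
      ext x; simp [PiLp.inner_apply]
    rw [this]
    exact memLp_finsetSum _ fun i _ => (hc i).mul_const _
  refine ⟨hm.integrable (by norm_num), hm.integrable_sq, ?_, ?_⟩
  · rw [integral_inner hid, hcent, inner_zero_right]
  · have : ∀ x : Euc n, (inner ℝ u x) ^ 2 = ∑ i, ∑ j, (u i * u j) * (x i * x j) := by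
      intro x
      simp only [PiLp.inner_apply, pow_two, Finset.sum_mul_sum]
      refine Finset.sum_congr rfl fun i _ => Finset.sum_congr rfl fun j _ => ?_
      simp; ring
    simp only [this]
    have hprodint : ∀ i j, Integrable (fun x : Euc n => (u i * u j) * (x i * x j)) μ := fun i j =>
      ((hc i).integrable_mul (hc j)).const_mul _
    rw [integral_finsetSum _ fun i _ => integrable_finsetSum _ fun j _ => hprodint i j]
    simp_rw [integral_finsetSum _ fun j _ => hprodint _ j, integral_const_mul, hiso]
    rw [EuclideanSpace.norm_sq_eq]
    simp [pow_two]

lemma key_lower {n : ℕ} (hn : 1 ≤ n) {f : Euc n → ℝ} {μ : Measure (Euc n)} [IsProbabilityMeasure μ]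
    (hf : IsLogConcaveFn f)
    (hμ : μ = volume.withDensity (fun x => ENNReal.ofReal (f x)))
    (hcent : ∫ x, x ∂μ = 0)
    (hiso : ∀ i j : Fin n, ∫ x, x i * x j ∂μ = if i = j then 1 else 0)
    (x0 y : Euc n) (hy : ‖y‖ ≤ 9 / 17) : Real.exp (-(8 * n)) * f x0 ≤ f y := by
  rcases (hf.1 x0).eq_or_lt with h0 | h0
  · rw [← h0, mul_zero]; exact hf.1 y
  have lt := low_tail hn hf hμ x0 h0
  set L := {x | Real.exp (-(8 * n)) * f x0 ≤ f x} with hL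
  by_contra hcon
  have hyL : y ∉ interior L := fun h => hcon (show y ∈ L from interior_subset h)
  obtain ⟨g, hg⟩ := geometric_hahn_banach_open_point (hf.convex_le _).interior isOpen_interior hyL
  obtain ⟨v, rfl⟩ := (InnerProductSpace.toDual ℝ (Euc n)).surjective g
  simp only [InnerProductSpace.toDual_apply_apply] at hg
  have hv : v ≠ 0 := by
    rintro rfl
    have : interior L = ∅ := by
      ext a
      simp only [mem_empty_iff_false, iff_false]
      intro ha
      have := hg a ha
      simp at this
    rw [this, compl_empty] at lt
    simp at lt
    norm_num at lt
  have hv' : 0 < ‖v‖ := norm_pos_iff.2 hv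
  set u : Euc n := ‖v‖⁻¹ • v with hu
  have hu1 : ‖u‖ = 1 := by
    rw [hu, norm_smul, norm_inv, norm_norm, inv_mul_cancel₀ hv'.ne']
  have hgu : ∀ a ∈ interior L, inner ℝ u a < inner ℝ u y := by
    intro a ha
    rw [hu, real_inner_smul_left, real_inner_smul_left]
    exact mul_lt_mul_of_pos_left (hg a ha) (by positivity)
  obtain ⟨i1, i2, e1, e2⟩ := iso_inner hcent hiso u
  rw [hu1, one_pow] at e2
  have fpn : FP μ (fun x => - inner ℝ u x) := by
    have := fp_inner hf hμ (-u)
    simpa only [inner_neg_left] using this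
  have t := tail_core μ (by fun_prop) (fp_inner hf hμ u) fpn i1 i2 e1 e2
  have : μ.real {x | (9 / 17 : ℝ) ≤ inner ℝ u x} ≤ μ.real (interior L)ᶜ := by
    apply measureReal_mono _ (by finiteness)
    intro x hx hxi
    have h1 := hgu x hxi
    have h2 : inner ℝ u y ≤ ‖u‖ * ‖y‖ := real_inner_le_norm u y
    rw [hu1, one_mul] at h2
    have h3 : (9 / 17 : ℝ) ≤ inner ℝ u x := hx
    linarith
  linarith


lemma slice_one {a k : Set ℝ} {ε : ℝ} (hε : 0 ≤ ε) (ha : IsCompact a) (hac : a.OrdConnected)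
    (hk : Convex ℝ k) :
    volume (((a + Icc (-ε) ε) \ a) ∩ k) + volume k ≤ volume (k + Icc (-ε) ε) := by
  have h0 : (0 : ℝ) ∈ Icc (-ε) ε := ⟨by linarith, hε⟩
  have hsub : k ⊆ k + Icc (-ε) ε := fun x hx => ⟨x, hx, 0, h0, add_zero x⟩
  rcases k.eq_empty_or_nonempty with rfl | hkn
  · simp
  rcases a.eq_empty_or_nonempty with rfl | han
  · simpa using measure_mono hsub
  have hcon : IsConnected a := ⟨han, hac.isPreconnected⟩
  have hI := eq_Icc_of_connected_compact hcon ha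
  set p := sInf a
  set q := sSup a
  have h1 : volume (((a + Icc (-ε) ε) \ a) ∩ k) ≤ ENNReal.ofReal (2 * ε) := by
    calc _ ≤ volume (Ico (p - ε) p ∪ Ioc q (q + ε)) := by
          apply measure_mono
          rintro _ ⟨⟨⟨x, hx, y, hy, rfl⟩, hn⟩, -⟩
          rw [hI] at hx hn
          simp only [mem_Icc, not_and_or, not_le] at hx hn hy
          rcases hn with h | h
          · left; exact ⟨by dsimp only; linarith, h⟩
          · right; exact ⟨h, by dsimp only; linarith⟩
      _ ≤ volume (Ico (p - ε) p) + volume (Ioc q (q + ε)) := measure_union_le _ _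
      _ = _ := by
          rw [Real.volume_Ico, Real.volume_Ioc, ← ENNReal.ofReal_add (by linarith) (by linarith)]
          congr 1; ring
  have h2 := interval_bm (I := k) (J := Icc (-ε) ε) (H := k + Icc (-ε) ε) one_pos one_pos hkn
    ⟨0, h0⟩ (hk.add (convex_Icc _ _)).ordConnected
    (fun x hx y hy => ⟨x, hx, y, hy, by ring⟩)
  simp only [ENNReal.ofReal_one, one_mul, Real.volume_Icc] at h2
  calc _ ≤ ENNReal.ofReal (2 * ε) + volume k := by gcongr
    _ = volume k + ENNReal.ofReal (ε - -ε) := by rw [add_comm]; congr 2; ring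
    _ ≤ _ := h2

section cube
variable {n : ℕ}

/-- coordinate segment -/
def seg (n : ℕ) (ε : ℝ) (i : Fin n) : Set (Fin n → ℝ) := (fun t => Pi.single i t) '' Icc (-ε) ε

lemma seg_compact (ε : ℝ) (i : Fin n) : IsCompact (seg n ε i) :=
  isCompact_Icc.image (continuous_single (A := fun _ : Fin n => ℝ) i)

lemma seg_convex (ε : ℝ) (i : Fin n) : Convex ℝ (seg n ε i) :=
  (convex_Icc _ _).linear_image (LinearMap.single ℝ (fun _ : Fin n => ℝ) i)

lemma slice_add (X : Set (Fin n → ℝ)) (ε : ℝ) (i : Fin n) (x : Fin n → ℝ) :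
    {t | Function.update x i t ∈ X + seg n ε i} =
      {t | Function.update x i t ∈ X} + Icc (-ε) ε := by
  ext t
  constructor
  · rintro ⟨y, hy, _, ⟨s, hs, rfl⟩, h⟩
    refine ⟨t - s, ?_, s, hs, by simp⟩
    have : Function.update x i (t - s) = y := by
      ext j
      have hj := congrFun h j
      by_cases hji : j = i
      · subst hji; simp at hj ⊢; linarith
      · simp [hji] at hj ⊢; linarith
    rw [mem_ofPred_eq, this]; exact hy
  · rintro ⟨r, hr, s, hs, rfl⟩
    refine ⟨_, hr, _, ⟨s, hs, rfl⟩, ?_⟩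
    ext j
    by_cases hji : j = i
    · subst hji; simp
    · simp [hji]

lemma slice_convex {X : Set (Fin n → ℝ)} (hX : Convex ℝ X) (i : Fin n) (x : Fin n → ℝ) :
    Convex ℝ {t | Function.update x i t ∈ X} := by
  intro s hs t ht a b ha hb hab
  have := hX hs ht ha hb hab
  have e : a • Function.update x i s + b • Function.update x i t =
      Function.update x i (a • s + b • t) := by
    ext j
    by_cases hji : j = i
    · subst hji; simp
    · simp [hji, ← add_mul, hab]
  rw [e] at this
  exact this

lemma seg_step {A K : Set (Fin n → ℝ)} {ε : ℝ} (hε : 0 ≤ ε) (hA : IsCompact A)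
    (hAc : Convex ℝ A) (hK : IsOpen K) (hKc : Convex ℝ K) (i : Fin n) :
    volume (((A + seg n ε i) \ A) ∩ K) + volume K ≤ volume (K + seg n ε i) := by
  have m1 : MeasurableSet (((A + seg n ε i) \ A) ∩ K) :=
    ((hA.add (seg_compact ε i)).measurableSet.diff hA.measurableSet).inter hK.measurableSet
  have m2 : MeasurableSet K := hK.measurableSet
  have m3 : MeasurableSet (K + seg n ε i) := hK.add_right.measurableSet
  rw [← lintegral_indicator_one m1, ← lintegral_indicator_one m2, ← lintegral_indicator_one m3,
    ← lintegral_add_left (measurable_one.indicator m1)]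
  refine lintegral_le_of_lmarginal_le {i}
    ((measurable_one.indicator m1).add (measurable_one.indicator m2))
    (measurable_one.indicator m3) ?_
  rw [lmarginal_singleton, lmarginal_singleton]
  intro x
  have hu : Measurable (Function.update x i) := measurable_update x
  have huc : Continuous (Function.update x i) := continuous_const.update i continuous_id
  dsimp only
  have e : ∀ X : Set (Fin n → ℝ), MeasurableSet X →
      ∫⁻ t, X.indicator (1 : (Fin n → ℝ) → ENNReal) (Function.update x i t) =
        volume {t | Function.update x i t ∈ X} := by
    intro X hX
    exact lintegral_indicator_one (hu hX)
  have m1u : Measurable fun t => (((A + seg n ε i) \ A) ∩ K).indicator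
      (1 : (Fin n → ℝ) → ENNReal) (Function.update x i t) := (measurable_one.indicator m1).comp hu
  rw [lintegral_add_left m1u, e _ m1, e _ m2, e _ m3,
    slice_add]
  have ca : IsCompact {t | Function.update x i t ∈ A} := by
    refine (hA.image (continuous_apply i)).of_isClosed_subset (hA.isClosed.preimage huc) ?_
    intro t ht
    exact ⟨_, ht, by simp⟩
  have := slice_one hε ca (slice_convex hAc i x).ordConnected (slice_convex hKc i x)
  rw [← slice_add] at this
  exact this

lemma cube_step {ε : ℝ} (hε : 0 ≤ ε) (s : Finset (Fin n)) : ∀ {A K : Set (Fin n → ℝ)},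
    IsCompact A → Convex ℝ A → IsOpen K → Convex ℝ K →
    volume (((A + ∑ i ∈ s, seg n ε i) \ A) ∩ K) + volume K ≤ volume (K + ∑ i ∈ s, seg n ε i) := by
  classical
  induction s using Finset.induction_on with
  | empty => intro A K _ _ _ _; simp
  | insert i s his ih =>
    intro A K hA hAc hK hKc
    rw [Finset.sum_insert his, ← add_assoc, ← add_assoc]
    set Q := ∑ i ∈ s, seg n ε i
    have h1 := seg_step hε hA hAc hK hKc i
    have h2 := ih (hA.add (seg_compact ε i)) (hAc.add (seg_convex ε i)) (hK.add_right (t := seg n ε i))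
      (hKc.add (seg_convex ε i))
    have hKK : K ⊆ K + seg n ε i := fun x hx =>
      ⟨x, hx, 0, ⟨0, ⟨by linarith, hε⟩, by simp⟩, add_zero x⟩
    have hsub : ((A + seg n ε i + Q) \ A) ∩ K ⊆
        (((A + seg n ε i + Q) \ (A + seg n ε i)) ∩ (K + seg n ε i)) ∪
          (((A + seg n ε i) \ A) ∩ K) := by
      rintro x ⟨⟨h, h'⟩, hx⟩
      by_cases hm : x ∈ A + seg n ε i
      · exact Or.inr ⟨⟨hm, h'⟩, hx⟩
      · exact Or.inl ⟨⟨h, hm⟩, hKK hx⟩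
    calc _ ≤ (volume (((A + seg n ε i + Q) \ (A + seg n ε i)) ∩ (K + seg n ε i)) +
          volume (((A + seg n ε i) \ A) ∩ K)) + volume K := by
            gcongr; exact (measure_mono hsub).trans (measure_union_le _ _)
      _ ≤ volume (((A + seg n ε i + Q) \ (A + seg n ε i)) ∩ (K + seg n ε i)) +
          volume (K + seg n ε i) := by rw [add_assoc]; gcongr
      _ ≤ _ := h2

lemma mem_cube {ε : ℝ} (z : Fin n → ℝ) : z ∈ ∑ i, seg n ε i ↔ ∀ i, |z i| ≤ ε := by
  rw [Set.mem_fintype_sum]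
  constructor
  · rintro ⟨g, hg, rfl⟩ i
    have : (∑ j, g j) i = g i i := by
      rw [Finset.sum_apply]
      refine Finset.sum_eq_single i (fun j _ hj => ?_) (by simp)
      obtain ⟨t, ht, h⟩ := hg j
      rw [← h]; simp [hj.symm]
    rw [this]
    obtain ⟨t, ht, h⟩ := hg i
    rw [← h]; simpa [abs_le] using ht
  · intro h
    refine ⟨fun i => Pi.single i (z i), fun i => ⟨z i, abs_le.1 (h i), rfl⟩, ?_⟩
    exact Finset.univ_sum_single z

/-- Euclidean version of the cube inequality. -/
lemma cube_euc {ε : ℝ} (hε : 0 ≤ ε) {A K : Set (Euc n)}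
    (hA : IsCompact A) (hAc : Convex ℝ A) (hK : IsOpen K) (hKc : Convex ℝ K) :
    volume (((A + closedBall 0 ε) \ A) ∩ K) + volume K ≤
      volume (K + {z : Euc n | ∀ i, |z i| ≤ ε}) := by
  set e := (EuclideanSpace.equiv (Fin n) ℝ).symm with he
  have hev : ∀ X : Set (Euc n), volume X = volume (e ⁻¹' X) := by
    intro X
    exact ((PiLp.volume_preserving_toLp (Fin n)).measure_preimage_emb
        (MeasurableEquiv.toLp 2 (Fin n → ℝ)).measurableEmbedding X).symm
  have hadd : ∀ X Y : Set (Euc n), e ⁻¹' (X + Y) = e ⁻¹' X + e ⁻¹' Y := by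
    intro X Y
    ext x
    constructor
    · rintro ⟨a, ha, b, hb, h⟩
      refine ⟨e.symm a, by simpa using ha, e.symm b, by simpa using hb, ?_⟩
      apply e.injective
      simpa using h
    · rintro ⟨a, ha, b, hb, rfl⟩
      exact ⟨e a, ha, e b, hb, by simp⟩
  have hQ : e ⁻¹' {z : Euc n | ∀ i, |z i| ≤ ε} = ∑ i, seg n ε i := by
    ext z; rw [mem_cube]; rfl
  have hB : closedBall (0 : Euc n) ε ⊆ {z : Euc n | ∀ i, |z i| ≤ ε} := by
    intro z hz i
    rw [mem_closedBall_zero_iff] at hz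
    exact (PiLp.norm_apply_le z i).trans hz
  have c := cube_step hε Finset.univ (A := e ⁻¹' A) (K := e ⁻¹' K)
    (e.toHomeomorph.isCompact_preimage.2 hA) (hAc.linear_preimage e.toLinearMap)
    (hK.preimage e.continuous) (hKc.linear_preimage e.toLinearMap)
  rw [hev (K + _), hadd, hQ, hev K]
  refine le_trans ?_ c
  gcongr
  rw [hev, ← hQ]
  apply measure_mono
  rw [preimage_inter, preimage_sdiff, hadd]
  gcongr
end cube


lemma level_incl {n : ℕ} {f : Euc n → ℝ} (hf : IsLogConcaveFn f) (r ε : ℝ) (hr : 0 < r)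
    (hε : 0 < ε) (hrn : √n * r ≤ 9 / 17)
    (hkey : ∀ x0 y : Euc n, ‖y‖ ≤ 9 / 17 → Real.exp (-(8 * n)) * f x0 ≤ f y) (t : ℝ) :
    {x | t < f x} + {z : Euc n | ∀ i, |z i| ≤ ε} ⊆
      (1 + ε / r) • {x | t < Real.exp (8 * n * (ε / (r + ε))) * f x} := by
  rintro _ ⟨x, hx, z, hz, rfl⟩
  have hx : t < f x := hx
  have hc : 0 < 1 + ε / r := by positivity
  rw [mem_smul_set_iff_inv_smul_mem₀ hc.ne']
  refine lt_of_lt_of_le hx ?_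
  set s := ε / (r + ε) with hs
  have hs0 : 0 ≤ s := by positivity
  have hs1 : s ≤ 1 := by rw [hs, div_le_one (by positivity)]; linarith
  set y : Euc n := (r / ε) • z with hy
  have hyn : ‖y‖ ≤ 9 / 17 := by
    refine le_trans ?_ hrn
    have hzn : ‖z‖ ≤ √n * ε := by
      rw [EuclideanSpace.norm_eq]
      calc √(∑ i, ‖z i‖ ^ 2) ≤ √(∑ i : Fin n, ε ^ 2) := by
            apply Real.sqrt_le_sqrt
            refine Finset.sum_le_sum fun i _ => ?_
            have := hz i
            rw [Real.norm_eq_abs]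
            gcongr
        _ = _ := by
            simp [Real.sqrt_sq hε.le]
    rw [hy, norm_smul, Real.norm_of_nonneg (by positivity)]
    calc r / ε * ‖z‖ ≤ r / ε * (√n * ε) := by gcongr
      _ = _ := by field_simp
  have h1 := hf.2 y x s hs0 hs1
  have e : s • y + (1 - s) • x = (1 + ε / r)⁻¹ • (x + z) := by
    rw [hy, smul_smul, smul_add, add_comm]
    congr 2
    · rw [hs]; field_simp; ring
    · rw [hs]; field_simp
  rw [e] at h1
  have h2 : Real.exp (-(8 * n * s)) * f x ≤ f y ^ s * f x ^ (1 - s) := by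
    rcases (hf.1 x).eq_or_lt with h0 | h0
    · rw [← h0, mul_zero]; have := hf.1 y; positivity
    calc _ = (Real.exp (-(8 * n)) * f x) ^ s * f x ^ (1 - s) := by
          rw [Real.mul_rpow (Real.exp_pos _).le h0.le, ← Real.exp_mul,
            mul_assoc (Real.exp _), ← Real.rpow_add h0, neg_mul, add_sub_cancel, Real.rpow_one]
      _ ≤ _ := by
          gcongr
          exact hkey x y hyn
  calc f x = Real.exp (8 * n * s) * (Real.exp (-(8 * n * s)) * f x) := by
        rw [← mul_assoc, ← Real.exp_add]; simp
    _ ≤ _ := by gcongr; exact h2.trans h1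

lemma perim_bound {n : ℕ} (hn : 1 ≤ n) {f : Euc n → ℝ} {μ : Measure (Euc n)}
    [IsProbabilityMeasure μ] (hf : IsLogConcaveFn f)
    (hμ : μ = volume.withDensity (fun x => ENNReal.ofReal (f x)))
    (r ε : ℝ) (hr : 0 < r) (hε : 0 < ε) (hrn : √n * r ≤ 9 / 17)
    (hkey : ∀ x0 y : Euc n, ‖y‖ ≤ 9 / 17 → Real.exp (-(8 * n)) * f x0 ≤ f y)
    {A : Set (Euc n)} (hA : IsCompact A) (hAc : Convex ℝ A) :
    μ ((A + closedBall 0 ε) \ A) + 1 ≤ ENNReal.ofReal (Real.exp (9 * n / r * ε)) := by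
  have tot : ∫⁻ x, ENNReal.ofReal (f x) = 1 := by
    have := measure_univ (μ := μ)
    rw [hμ, withDensity_apply _ MeasurableSet.univ, Measure.restrict_univ] at this
    exact this
  have fm : AEMeasurable f := by
    have h1 : AEMeasurable (fun x => ENNReal.ofReal (f x)) := aemeas_of_convex _ hf.lc.convex
    have := h1.ennreal_toReal
    simpa only [ENNReal.toReal_ofReal (hf.1 _)] using this
  set D := (A + closedBall 0 ε) \ A with hD
  have mD : MeasurableSet D :=
    (hA.add (isCompact_closedBall _ _)).measurableSet.diff hA.measurableSet
  set c := 1 + ε / r with hc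
  have hc0 : 0 < c := by positivity
  set l := Real.exp (8 * n * (ε / (r + ε))) with hl
  have hl0 : 0 < l := Real.exp_pos _
  have pt : ∀ t, volume.restrict D {x | t < f x} + volume {x | t < f x} ≤
      ENNReal.ofReal (c ^ n) * volume {x | t < l * f x} := by
    intro t
    have hcv := hf.convex_lt t
    have hae : interior {x | t < f x} =ᵐ[volume] {x | t < f x} :=
      interior_ae_eq_of_null_frontier (hcv.addHaar_frontier volume)
    have h1 := cube_euc hε.le hA hAc (isOpen_interior (s := {x | t < f x})) hcv.interior
    rw [← hD] at h1
    rw [Measure.restrict_apply' mD, inter_comm, ← measure_congr hae,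
      ← measure_congr ((ae_eq_refl D).inter hae)]
    refine h1.trans ?_
    calc _ ≤ volume (c • {x | t < l * f x}) := by
          apply measure_mono
          refine (add_subset_add_right interior_subset).trans ?_
          exact level_incl hf r ε hr hε hrn hkey t
      _ = _ := by
          rw [Measure.addHaar_smul]
          simp [abs_of_pos hc0]
  have m1 : Measurable fun t => volume.restrict D {x | t < f x} :=
    Antitone.measurable fun s t hst => measure_mono fun x hx => lt_of_le_of_lt hst hx
  have m2 : Measurable fun t => volume {x | t < l * f x} :=
    Antitone.measurable fun s t hst => measure_mono fun x hx => lt_of_le_of_lt hst hx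
  calc μ D + 1 = (∫⁻ x in D, ENNReal.ofReal (f x)) + ∫⁻ x, ENNReal.ofReal (f x) := by
        rw [tot, hμ, withDensity_apply _ mD]
    _ = ∫⁻ t in Ioi 0, (volume.restrict D {x | t < f x} + volume {x | t < f x}) := by
        rw [lintegral_eq_lintegral_meas_lt _ (ae_of_all _ hf.1) fm.restrict,
          lintegral_eq_lintegral_meas_lt _ (ae_of_all _ hf.1) fm, lintegral_add_left m1]
    _ ≤ ∫⁻ t in Ioi 0, ENNReal.ofReal (c ^ n) * volume {x | t < l * f x} :=
        lintegral_mono pt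
    _ = ENNReal.ofReal (c ^ n) * ENNReal.ofReal l := by
        rw [lintegral_const_mul _ m2, ← lintegral_eq_lintegral_meas_lt volume
          (ae_of_all _ fun x => mul_nonneg hl0.le (hf.1 x)) (fm.const_mul l)]
        simp_rw [ENNReal.ofReal_mul hl0.le]
        rw [lintegral_const_mul' _ _ ENNReal.ofReal_ne_top, tot, mul_one]
    _ ≤ _ := by
        rw [← ENNReal.ofReal_mul (by positivity)]
        apply ENNReal.ofReal_le_ofReal
        calc c ^ n * l ≤ Real.exp (ε / r) ^ n * Real.exp (8 * n * (ε / r)) := by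
              gcongr
              · rw [hc, add_comm]; exact Real.add_one_le_exp _
              · rw [hl]; gcongr; linarith
          _ = _ := by
              rw [← Real.exp_nat_mul, ← Real.exp_add]
              congr 1; field_simp; ring

lemma liminf_bound {u : ℝ → ℝ} {c : ℝ} (hc : 0 ≤ c)
    (h : ∀ ε > 0, u ε ≤ (Real.exp (c * ε) - 1) / ε) :
    liminf u (nhdsWithin 0 (Ioi 0)) ≤ c := by
  rw [liminf_eq]
  apply Real.sSup_le _ hc
  intro a ha
  have ha : ∀ᶠ ε in nhdsWithin 0 (Ioi 0), a ≤ u ε := ha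
  have hd : HasDerivAt (fun ε => Real.exp (c * ε)) c 0 := by
    have := ((hasDerivAt_id (0:ℝ)).const_mul c).exp
    simpa using this
  have ht : Tendsto (fun ε : ℝ => (Real.exp (c * ε) - 1) / ε) (nhdsWithin 0 (Ioi 0)) (nhds c) := by
    have := hd.tendsto_slope_zero_right
    refine this.congr fun ε => ?_
    simp [div_eq_inv_mul]
  refine ge_of_tendsto ht ?_
  filter_upwards [ha, self_mem_nhdsWithin] with ε h1 h2
  exact h1.trans (h ε h2)

theorem max_perimeter_upper_bound {n : ℕ} (f : Euc n → ℝ) (μ : Measure (Euc n))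
    [IsProbabilityMeasure μ]
    (hf : IsLogConcaveFn f)
    (hμ : μ = volume.withDensity (fun x => ENNReal.ofReal (f x)))
    (hcent : ∫ x, x ∂μ = 0)
    (hiso : ∀ i j : Fin n, ∫ x, x i * x j ∂μ = if i = j then 1 else 0)
    (A : Set (Euc n)) (hA : IsConvexBody A) :
    muPerim μ A ≤ 17 * (n : ℝ) ^ ((3 : ℝ) / 2) := by
  obtain ⟨hAc, hAk, hAi⟩ := hA
  refine liminf_bound (by positivity) fun ε hε => ?_
  rcases Nat.eq_zero_or_pos n with rfl | hn
  · obtain ⟨a, ha⟩ := hAi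
    have hD : (A + closedBall (0 : Euc 0) ε) \ A = ∅ := by
      ext x
      have : x = a := Subsingleton.elim _ _
      subst this
      simp only [Set.mem_sdiff, mem_empty_iff_false, iff_false, not_and, not_not]
      exact fun _ => interior_subset ha
    rw [hD]
    have : (3 : ℝ) / 2 ≠ 0 := by norm_num
    simp [Real.zero_rpow this]
  have hn0 : (0 : ℝ) < n := by exact_mod_cast hn
  have hs : 0 < √(n : ℝ) := Real.sqrt_pos.2 hn0
  set r : ℝ := 9 / 17 / √n with hr
  have hr0 : 0 < r := by positivity
  have hrn : √n * r ≤ 9 / 17 := by rw [hr]; field_simp; exact le_refl _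
  have b := perim_bound hn hf hμ r ε hr0 hε hrn (key_lower hn hf hμ hcent hiso) hAk hAc
  have ec : 9 * n / r = 17 * (n : ℝ) ^ ((3 : ℝ) / 2) := by
    have : (3 : ℝ) / 2 = 1 + 1 / 2 := by norm_num
    rw [this, Real.rpow_add hn0, Real.rpow_one, ← Real.sqrt_eq_rpow, hr]
    field_simp
  rw [ec] at b
  have b2 := ENNReal.toReal_le_of_le_ofReal (Real.exp_pos _).le b
  rw [ENNReal.toReal_add (by finiteness) (by finiteness), ENNReal.toReal_one] at b2
  gcongr
  linarith
end
end

section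
/- Let K be an isotropic convex body in ℝ^n and let μ_K be the probability measure on ℝ^n with density f_K = L_K^n · 𝟙_{K/L_K}. Then Γ(μ_K) ≤ √(n/(n+2)) · n. -/
open MeasureTheory Metric Filter Set Pointwise
open scoped RealInnerProductSpace

noncomputable section

/-- The maximal perimeter constant `Γ(μ)`. -/
def Gamma {n : ℕ} (μ : Measure (Euc n)) : ℝ :=
  sSup {x | ∃ A : Set (Euc n), IsConvexBody A ∧ x = muPerim μ A}

/-- The surface area of `K`: the `(n-1)`-dimensional Hausdorff measure of `∂K`. -/
def surfaceArea {n : ℕ} (K : Set (Euc n)) : ℝ :=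
  (μH[((n : ℝ) - 1)] (frontier K)).toReal

section Helpers
open scoped ENNReal

lemma amgm_ennreal (a b : ℝ) (ha : 0 < a) (hb : 0 < b) (hab : a + b = 1) (X Y : ℝ≥0∞) :
    X ^ a * Y ^ b ≤ ENNReal.ofReal a * X + ENNReal.ofReal b * Y := by
  by_cases hX : X = ⊤
  · subst hX
    rw [ENNReal.mul_top (by simpa using ha)]; simp
  by_cases hY : Y = ⊤
  · subst hY
    rw [ENNReal.mul_top (by simpa using hb)]; simp
  lift X to NNReal using hX
  lift Y to NNReal using hY
  have := Real.geom_mean_le_arith_mean2_weighted ha.le hb.le X.2 Y.2 hab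
  rw [← ENNReal.coe_rpow_of_nonneg _ ha.le, ← ENNReal.coe_rpow_of_nonneg _ hb.le,
    ENNReal.ofReal_eq_coe_nnreal ha.le, ENNReal.ofReal_eq_coe_nnreal hb.le]
  norm_cast

lemma vol_add_compact {A B : Set ℝ} (hA : IsCompact A) (hB : IsCompact B) (hA0 : A.Nonempty)
    (hB0 : B.Nonempty) : volume A + volume B ≤ volume (A + B) := by
  obtain ⟨m, hm, hm'⟩ := hA.exists_isGreatest hA0
  obtain ⟨l, hl, hl'⟩ := hB.exists_isLeast hB0
  have h1 : (fun x => x + l) '' A ∪ (fun x => m + x) '' B ⊆ A + B := by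
    rintro _ (⟨x, hx, rfl⟩ | ⟨x, hx, rfl⟩)
    · exact add_mem_add hx hl
    · exact add_mem_add hm hx
  have hB' : MeasurableSet ((fun x => m + x) '' B) := (hB.image (by fun_prop)).isClosed.measurableSet
  have h2 : AEDisjoint volume ((fun x => x + l) '' A) ((fun x => m + x) '' B) := by
    refine measure_mono_null (t := {m + l}) ?_ (by simp)
    rintro _ ⟨⟨x, hx, rfl⟩, ⟨y, hy, hxy⟩⟩
    have := hm' hx
    have := hl' hy
    simp only [mem_singleton_iff] at *
    linarith
  calc volume A + volume B = volume ((fun x => x + l) '' A) + volume ((fun x => m + x) '' B) := by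
        simp [measure_preimage_add_right, measure_preimage_add]
    _ = volume ((fun x => x + l) '' A ∪ (fun x => m + x) '' B) :=
        (measure_union₀ hB'.nullMeasurableSet h2).symm
    _ ≤ _ := measure_mono h1

lemma vol_add_meas {A B S : Set ℝ} (hA : MeasurableSet A) (hB : MeasurableSet B) (hA0 : A.Nonempty)
    (hB0 : B.Nonempty) (hS : A + B ⊆ S) : volume A + volume B ≤ volume S := by
  obtain ⟨x, hx⟩ := hA0
  obtain ⟨y, hy⟩ := hB0
  rw [hA.measure_eq_iSup_isCompact, hB.measure_eq_iSup_isCompact]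
  have hs : ∀ A : Set ℝ, (⨆ (K : Set ℝ) (_ : K ⊆ A) (_ : IsCompact K), volume K) =
      ⨆ (K : Set ℝ) (_ : K ⊆ A ∧ IsCompact K), volume K := by
    intro A; simp only [iSup_and]
  rw [hs, hs]
  refine ENNReal.biSup_add_biSup_le' ⟨∅, by simp⟩ ⟨∅, by simp⟩ ?_
  rintro C ⟨hC, hC'⟩ D ⟨hD, hD'⟩
  have h1 : volume C ≤ volume (insert x C) := measure_mono (subset_insert _ _)
  have h2 : volume D ≤ volume (insert y D) := measure_mono (subset_insert _ _)
  refine (add_le_add h1 h2).trans ((vol_add_compact (hC'.insert x) (hD'.insert y)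
    (insert_nonempty _ _) (insert_nonempty _ _)).trans (measure_mono ?_))
  exact (add_subset_add (insert_subset hx hC) (insert_subset hy hD)).trans hS

lemma vol_comb {A B S : Set ℝ} {a b : ℝ} (ha : 0 < a) (hb : 0 < b)
    (hA : MeasurableSet A) (hB : MeasurableSet B) (hA0 : A.Nonempty)
    (hB0 : B.Nonempty) (hS : ∀ x ∈ A, ∀ y ∈ B, a • x + b • y ∈ S) :
    ENNReal.ofReal a * volume A + ENNReal.ofReal b * volume B ≤ volume S := by
  have := vol_add_meas (A := a • A) (B := b • B) (S := S) (hA.const_smul₀ a) (hB.const_smul₀ b)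
    (hA0.smul_set) (hB0.smul_set) (by
      rintro _ ⟨_, ⟨x, hx, rfl⟩, _, ⟨y, hy, rfl⟩, rfl⟩
      exact hS x hx y hy)
  simpa [Measure.addHaar_smul, abs_of_pos ha, abs_of_pos hb] using this

lemma pl_norm (a b : ℝ) (ha : 0 < a) (hb : 0 < b) (hab : a + b = 1) (f g h : ℝ → ℝ≥0∞)
    (hf : Measurable f) (hg : Measurable g) (hh : Measurable h)
    (hf1 : ∀ x, f x ≤ 1) (hg1 : ∀ x, g x ≤ 1) (hf2 : ∀ t < 1, ∃ x, t < f x)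
    (hg2 : ∀ t < 1, ∃ x, t < g x)
    (H : ∀ x y, f x ^ a * g y ^ b ≤ h (a • x + b • y)) :
    ENNReal.ofReal a * (∫⁻ x, f x) + ENNReal.ofReal b * (∫⁻ x, g x) ≤ ∫⁻ x, h x := by
  have key : ∀ u : ℝ → ℝ≥0∞, Measurable u → (∀ x, u x ≤ 1) →
      ∫⁻ x, u x = ∫⁻ t in Ioi (0 : ℝ), volume {x | ENNReal.ofReal t < u x} := by
    intro u hu hu1
    have hfin : ∀ x, u x ≠ ⊤ := fun x => ((hu1 x).trans_lt (by simp)).ne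
    have := lintegral_eq_lintegral_meas_lt volume (f := fun x => (u x).toReal)
      (Eventually.of_forall fun x => ENNReal.toReal_nonneg) hu.ennreal_toReal.aemeasurable
    simp only [ENNReal.ofReal_toReal (hfin _)] at this
    rw [this]
    refine setLIntegral_congr_fun measurableSet_Ioi fun t ht => ?_
    simp only [ENNReal.ofReal_lt_iff_lt_toReal (le_of_lt ht) (hfin _)]
  have mono : ∀ u : ℝ → ℝ≥0∞, Measurable fun t : ℝ => volume {x | ENNReal.ofReal t < u x} := by
    intro u
    apply Antitone.measurable
    intro s t hst
    exact measure_mono fun x hx => (ENNReal.ofReal_le_ofReal hst).trans_lt hx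
  have hle : ∫⁻ x, min (h x) 1 ≤ ∫⁻ x, h x := lintegral_mono fun x => min_le_left _ _
  refine le_trans ?_ hle
  rw [key f hf hf1, key g hg hg1, key _ (hh.min measurable_const) (fun x => min_le_right _ _),
    ← lintegral_const_mul _ (mono f), ← lintegral_const_mul _ (mono g), ← lintegral_add_left ((mono f).const_mul _)]
  refine setLIntegral_mono' measurableSet_Ioi fun t ht => ?_
  have ht : 0 < t := ht
  by_cases ht1 : 1 ≤ t
  · have e1 : {x | ENNReal.ofReal t < f x} = ∅ := by
      ext x; simpa using (hf1 x).trans (by simpa using ht1)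
    have e2 : {x | ENNReal.ofReal t < g x} = ∅ := by
      ext x; simpa using (hg1 x).trans (by simpa using ht1)
    simp [e1, e2]
  push Not at ht1
  have ht1' : ENNReal.ofReal t < 1 := by simpa using ht1
  refine vol_comb ha hb (measurableSet_lt measurable_const hf) (measurableSet_lt measurable_const hg)
    (hf2 _ ht1') (hg2 _ ht1') ?_
  intro x hx y hy
  refine lt_min ?_ ht1'
  refine lt_of_lt_of_le ?_ (H x y)
  have h0 : ENNReal.ofReal t = ENNReal.ofReal t ^ a * ENNReal.ofReal t ^ b := by
    rw [← ENNReal.rpow_add _ _ (by simpa using ht) (by simp), hab, ENNReal.rpow_one]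
  rw [h0]
  exact ENNReal.mul_lt_mul (ENNReal.rpow_lt_rpow hx ha) (ENNReal.rpow_lt_rpow hy hb)

def PL (E : Type*) [AddCommGroup E] [Module ℝ E] [MeasureSpace E] : Prop :=
  ∀ (a b : ℝ), 0 < a → 0 < b → a + b = 1 → ∀ f g h : E → ℝ≥0∞, Measurable f → Measurable g →
    Measurable h → (∀ x y, f x ^ a * g y ^ b ≤ h (a • x + b • y)) →
    (∫⁻ x, f x) ^ a * (∫⁻ x, g x) ^ b ≤ ∫⁻ x, h x

lemma pl_bdd (a b : ℝ) (ha : 0 < a) (hb : 0 < b) (hab : a + b = 1) (f g h : ℝ → ℝ≥0∞)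
    (hf : Measurable f) (hg : Measurable g) (hh : Measurable h)
    (hf1 : ⨆ x, f x ≠ ⊤) (hg1 : ⨆ x, g x ≠ ⊤)
    (H : ∀ x y, f x ^ a * g y ^ b ≤ h (a • x + b • y)) :
    (∫⁻ x, f x) ^ a * (∫⁻ x, g x) ^ b ≤ ∫⁻ x, h x := by
  set M := ⨆ x, f x with hM
  set N := ⨆ x, g x with hN
  by_cases hM0 : M = 0
  · have : ∀ x, f x = 0 := by simpa [hM] using hM0
    simp [this, ha]
  by_cases hN0 : N = 0
  · have : ∀ x, g x = 0 := by simpa [hN] using hN0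
    simp [this, hb]
  have main := pl_norm a b ha hb hab (fun x => M⁻¹ * f x) (fun x => N⁻¹ * g x)
    (fun x => (M⁻¹ ^ a * N⁻¹ ^ b) * h x) (hf.const_mul _) (hg.const_mul _) (hh.const_mul _)
    ?_ ?_ ?_ ?_ ?_
  · rw [lintegral_const_mul _ hf, lintegral_const_mul _ hg, lintegral_const_mul _ hh] at main
    have := (amgm_ennreal a b ha hb hab _ _).trans main
    rw [ENNReal.mul_rpow_of_nonneg _ _ ha.le, ENNReal.mul_rpow_of_nonneg _ _ hb.le,
      mul_mul_mul_comm] at this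
    have h1 : M⁻¹ ^ a ≠ 0 := by simp [ENNReal.rpow_eq_zero_iff, hf1, ha.le, ha]
    have h2 : N⁻¹ ^ b ≠ 0 := by simp [ENNReal.rpow_eq_zero_iff, hg1, hb.le, hb]
    have h3 : M⁻¹ ^ a ≠ ⊤ := ENNReal.rpow_ne_top_of_nonneg ha.le (by simpa using hM0)
    have h4 : N⁻¹ ^ b ≠ ⊤ := ENNReal.rpow_ne_top_of_nonneg hb.le (by simpa using hN0)
    exact (ENNReal.mul_le_mul_iff_right (mul_ne_zero h1 h2) (ENNReal.mul_ne_top h3 h4)).1 this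
  · intro x
    rw [mul_comm, ← div_eq_mul_inv]
    exact ENNReal.div_le_of_le_mul (by simpa using le_iSup f x)
  · intro x
    rw [mul_comm, ← div_eq_mul_inv]
    exact ENNReal.div_le_of_le_mul (by simpa using le_iSup g x)
  · intro t ht
    have : t * M < ⨆ x, f x := by
      rw [← hM]; simpa using ENNReal.mul_lt_mul_left hM0 hf1 ht
    obtain ⟨x, hx⟩ := lt_iSup_iff.1 this
    refine ⟨x, ?_⟩
    rw [mul_comm, ← div_eq_mul_inv]
    exact (ENNReal.lt_div_iff_mul_lt (.inl hM0) (.inl hf1)).2 hx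
  · intro t ht
    have : t * N < ⨆ x, g x := by
      rw [← hN]; simpa using ENNReal.mul_lt_mul_left hN0 hg1 ht
    obtain ⟨x, hx⟩ := lt_iSup_iff.1 this
    refine ⟨x, ?_⟩
    rw [mul_comm, ← div_eq_mul_inv]
    exact (ENNReal.lt_div_iff_mul_lt (.inl hN0) (.inl hg1)).2 hx
  · intro x y
    rw [ENNReal.mul_rpow_of_nonneg _ _ ha.le, ENNReal.mul_rpow_of_nonneg _ _ hb.le,
      mul_mul_mul_comm]
    gcongr
    exact H x y

lemma lint_trunc (f : ℝ → ℝ≥0∞) (hf : Measurable f) :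
    ∫⁻ x, f x = ⨆ k : ℕ, ∫⁻ x, min (f x) k := by
  rw [← lintegral_iSup (fun k => hf.min measurable_const) (fun i j hij x => by
    dsimp only; gcongr)]
  congr 1; ext x
  rw [← inf_iSup_eq, ENNReal.iSup_natCast]; simp

lemma pl_real : PL ℝ := by
  intro a b ha hb hab f g h hf hg hh H
  rw [lint_trunc f hf, lint_trunc g hg]
  have e : ∀ c : ℝ, 0 < c → ∀ u : ℕ → ℝ≥0∞, (⨆ k, u k) ^ c = ⨆ k, u k ^ c := by
    intro c hc u
    exact (ENNReal.orderIsoRpow c hc).map_iSup u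
  rw [e a ha, e b hb, ENNReal.iSup_mul]
  refine iSup_le fun k => ?_
  rw [ENNReal.mul_iSup]
  refine iSup_le fun l => ?_
  refine pl_bdd a b ha hb hab _ _ h (hf.min measurable_const) (hg.min measurable_const) hh ?_ ?_ ?_
  · exact ((iSup_le fun x => min_le_right _ _).trans_lt (ENNReal.natCast_lt_top k)).ne
  · exact ((iSup_le fun x => min_le_right _ _).trans_lt (ENNReal.natCast_lt_top l)).ne
  · intro x y
    refine le_trans ?_ (H x y)
    gcongr <;> exact min_le_left _ _

lemma pl_prod (E F : Type*) [AddCommGroup E] [Module ℝ E] [MeasureSpace E]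
    [AddCommGroup F] [Module ℝ F] [MeasureSpace F] [SFinite (volume : Measure E)]
    [SFinite (volume : Measure F)] (hE : PL E) (hF : PL F) : PL (E × F) := by
  intro a b ha hb hab f g h hf hg hh H
  rw [Measure.volume_eq_prod, lintegral_prod _ hf.aemeasurable, lintegral_prod _ hg.aemeasurable,
    lintegral_prod _ hh.aemeasurable]
  refine hE a b ha hb hab _ _ _ hf.lintegral_prod_right' hg.lintegral_prod_right'
    hh.lintegral_prod_right' fun x y => ?_
  exact hF a b ha hb hab (fun z => f (x, z)) (fun z => g (y, z)) (fun z => h (a • x + b • y, z))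
    (by fun_prop) (by fun_prop) (by fun_prop) fun z w => H (x, z) (y, w)

lemma pl_equiv (E F : Type*) [AddCommGroup E] [Module ℝ E] [MeasureSpace E]
    [AddCommGroup F] [Module ℝ F] [MeasureSpace F] (e : E → F) (he : MeasurePreserving e)
    (hlin : ∀ (a b : ℝ) x y, e (a • x + b • y) = a • e x + b • e y) (hE : PL E) : PL F := by
  intro a b ha hb hab f g h hf hg hh H
  rw [← he.lintegral_comp hf, ← he.lintegral_comp hg, ← he.lintegral_comp hh]
  refine hE a b ha hb hab _ _ _ (hf.comp he.measurable) (hg.comp he.measurable)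
    (hh.comp he.measurable) fun x y => ?_
  rw [hlin]
  exact H _ _

lemma pl_pi (n : ℕ) : PL (Fin n → ℝ) := by
  induction n with
  | zero =>
    intro a b ha hb hab f g h hf hg hh H
    have := H 0 0
    rw [Subsingleton.elim (a • (0 : Fin 0 → ℝ) + b • 0) 0] at this
    rw [volume_pi, Measure.pi_of_empty _ 0]
    simpa [lintegral_dirac] using this
  | succ n ih =>
    refine pl_equiv _ _ _ (volume_preserving_piFinSuccAbove (fun _ : Fin (n + 1) => ℝ) 0).symm ?_
      (pl_prod _ _ pl_real ih)
    intro a b x y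
    ext i
    refine Fin.cases ?_ (fun j => ?_) i <;> simp [MeasurableEquiv.piFinSuccAbove]

lemma pl_euc (n : ℕ) : PL (EuclideanSpace ℝ (Fin n)) :=
  pl_equiv _ _ _ (PiLp.volume_preserving_toLp (Fin n)) (by intros; rfl) (pl_pi n)

lemma bm {n : ℕ} {A B S : Set (EuclideanSpace ℝ (Fin n))} (hA : MeasurableSet A)
    (hB : MeasurableSet B) (hS : MeasurableSet S) {a b α β : ℝ} (ha : 0 < a) (hb : 0 < b)
    (hα : 0 < α) (hβ : 0 < β) (hvA : volume A = ENNReal.ofReal (α ^ n))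
    (hvB : volume B = ENNReal.ofReal (β ^ n)) (H : ∀ x ∈ A, ∀ y ∈ B, a • x + b • y ∈ S) :
    ENNReal.ofReal ((a * α + b * β) ^ n) ≤ volume S := by
  set s := a * α + b * β with hs
  have hs0 : 0 < s := by positivity
  have hmeas : ∀ (c : ℝ), 0 < c → ∀ X : Set (EuclideanSpace ℝ (Fin n)),
      volume X = ENNReal.ofReal (c ^ n) → volume (c⁻¹ • X) = 1 := by
    intro c hc X hX
    rw [Measure.addHaar_smul, hX, ← ENNReal.ofReal_mul (abs_nonneg _)]
    simp [abs_of_pos hc, hc.ne']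
  have e1 : a * α / s + b * β / s = 1 := by rw [← add_div, ← hs, div_self hs0.ne']
  have key := pl_euc n (a * α / s) (b * β / s) (by positivity) (by positivity) e1
    ((α⁻¹ • A).indicator 1) ((β⁻¹ • B).indicator 1) ((s⁻¹ • S).indicator 1)
    (measurable_one.indicator (hA.const_smul₀ _)) (measurable_one.indicator (hB.const_smul₀ _))
    (measurable_one.indicator (hS.const_smul₀ _)) ?_
  · rw [lintegral_indicator_one (hA.const_smul₀ _), lintegral_indicator_one (hB.const_smul₀ _),
      lintegral_indicator_one (hS.const_smul₀ _), hmeas α hα A hvA, hmeas β hβ B hvB,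
      Measure.addHaar_smul] at key
    simp only [ENNReal.one_rpow, mul_one, finrank_euclideanSpace, Fintype.card_fin] at key
    calc ENNReal.ofReal (s ^ n) = ENNReal.ofReal (s ^ n) * 1 := by rw [mul_one]
      _ ≤ ENNReal.ofReal (s ^ n) * (ENNReal.ofReal |s⁻¹ ^ n| * volume S) := by gcongr
      _ = volume S := by
        rw [← mul_assoc, ← ENNReal.ofReal_mul (by positivity), abs_of_pos (by positivity),
          ← mul_pow, mul_inv_cancel₀ hs0.ne']
        simp
  · intro x y
    by_cases hx : x ∈ α⁻¹ • A
    swap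
    · rw [indicator_of_notMem hx, ENNReal.zero_rpow_of_pos (by positivity)]; simp
    by_cases hy : y ∈ β⁻¹ • B
    swap
    · rw [indicator_of_notMem hy, ENNReal.zero_rpow_of_pos (by positivity)]; simp
    obtain ⟨x, hx', rfl⟩ := hx
    obtain ⟨y, hy', rfl⟩ := hy
    have : (a * α / s) • (fun x => α⁻¹ • x) x + (b * β / s) • (fun x => β⁻¹ • x) y ∈ s⁻¹ • S := by
      refine ⟨a • x + b • y, H x hx' y hy', ?_⟩
      simp only [smul_smul, smul_add]
      congr 2 <;> field_simp
    rw [indicator_of_mem this]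
    simp only [Pi.one_apply]
    refine mul_le_one' ?_ ?_
    · exact ENNReal.rpow_le_one (indicator_le_self' (by simp) _) (by positivity)
    · exact ENNReal.rpow_le_one (indicator_le_self' (by simp) _) (by positivity)

lemma psi_int (n : ℕ) (h : ℝ) (hh : 0 < h) :
    (∫ t in (0 : ℝ)..h, (1 - t / h) ^ n) = h / (n + 1) ∧
    (∫ t in (0 : ℝ)..h, t * (1 - t / h) ^ n) = h ^ 2 / ((n + 1) * (n + 2)) := by
  have hd : ∀ m : ℕ, ∀ t : ℝ, HasDerivAt (fun t : ℝ => -(h / (m + 1)) * (1 - t / h) ^ (m + 1))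
      ((1 - t / h) ^ m) t := by
    intro m t
    have h1 : HasDerivAt (fun t : ℝ => 1 - t / h) (-(1 / h)) t :=
      ((hasDerivAt_id t).div_const h).const_sub 1
    have := (h1.pow (m + 1)).const_mul (-(h / ((m : ℝ) + 1)))
    refine this.congr_deriv ?_
    have : (m : ℝ) + 1 ≠ 0 := by positivity
    push_cast
    field_simp
  have hI : ∀ m : ℕ, (∫ t in (0 : ℝ)..h, (1 - t / h) ^ m) = h / (m + 1) := by
    intro m
    rw [intervalIntegral.integral_eq_sub_of_hasDerivAt (fun t _ => hd m t)
      (by apply Continuous.intervalIntegrable; fun_prop)]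
    simp [hh.ne']
  refine ⟨hI n, ?_⟩
  have : ∀ t : ℝ, t * (1 - t / h) ^ n = h * (1 - t / h) ^ n - h * (1 - t / h) ^ (n + 1) := by
    intro t
    rw [pow_succ]; field_simp; ring
  simp only [this]
  rw [intervalIntegral.integral_sub (by apply Continuous.intervalIntegrable; fun_prop)
    (by apply Continuous.intervalIntegrable; fun_prop), intervalIntegral.integral_const_mul,
    intervalIntegral.integral_const_mul, hI, hI]
  push_cast
  have : (n : ℝ) + 1 ≠ 0 := by positivity
  have : (n : ℝ) + 2 ≠ 0 := by positivity
  have : (n : ℝ) + 1 + 1 ≠ 0 := by positivity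
  field_simp
  ring

lemma crossing (n : ℕ) (V : ℝ → ℝ) (hV : Antitone V) (b R : ℝ)
    (hb : 0 < b) (hR : (n + 1) * b ≤ R) (hint : ∫ t in (0 : ℝ)..R, V t = b)
    (hconc : ∀ t > 0, 0 < V t → ∀ β > 0, V t = β ^ n → ∀ s, 0 < s → s < 1 →
      ((1 - s) + s * β) ^ n ≤ V (s * t)) (hn : n ≠ 0) :
    ∫ t in (0 : ℝ)..R, t * V t ≤ (n + 1) / (n + 2) * b ^ 2 := by
  set h := (n + 1) * b with hh
  have hh0 : 0 < h := by positivity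
  have hR0 : 0 < R := hh0.trans_le hR
  set ψ : ℝ → ℝ := fun t => (max (1 - t / h) 0) ^ n with hψ
  have hψc : Continuous ψ := by fun_prop
  have hψ1 : EqOn ψ (fun t => (1 - t / h) ^ n) (uIcc 0 h) := by
    intro t ht
    rw [uIcc_of_le hh0.le] at ht
    have : t / h ≤ 1 := (div_le_one hh0).2 ht.2
    simp only [hψ]; rw [max_eq_left (by linarith)]
  have hψ2 : EqOn ψ (fun t => 0) (uIcc h R) := by
    intro t ht
    rw [uIcc_of_le hR] at ht
    have : 1 ≤ t / h := (one_le_div hh0).2 ht.1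
    simp only [hψ]; rw [max_eq_right (by linarith), zero_pow hn]
  have I1 : ∫ t in (0 : ℝ)..R, ψ t = b := by
    rw [← intervalIntegral.integral_add_adjacent_intervals (hψc.intervalIntegrable 0 h)
      (hψc.intervalIntegrable h R), intervalIntegral.integral_congr hψ1,
      intervalIntegral.integral_congr hψ2, (psi_int n h hh0).1]
    simp only [intervalIntegral.integral_zero, add_zero, hh]
    field_simp
  have I2 : ∫ t in (0 : ℝ)..R, t * ψ t = (n + 1) / (n + 2) * b ^ 2 := by
    have c2 : Continuous fun t => t * ψ t := by fun_prop
    rw [← intervalIntegral.integral_add_adjacent_intervals (c2.intervalIntegrable 0 h)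
      (c2.intervalIntegrable h R),
      intervalIntegral.integral_congr (g := fun t => t * (1 - t / h) ^ n)
        (fun t ht => by simp only [hψ1 ht]),
      intervalIntegral.integral_congr (a := h) (b := R) (g := fun t => 0)
        (fun t ht => by simp only [hψ2 ht, mul_zero]), (psi_int n h hh0).2]
    simp only [intervalIntegral.integral_zero, add_zero, hh]
    field_simp
  have iV : IntervalIntegrable V volume 0 R := hV.intervalIntegrable
  have itV : IntervalIntegrable (fun t => t * V t) volume 0 R :=
    iV.continuousOn_mul continuousOn_id
  have iψ : IntervalIntegrable ψ volume 0 R := hψc.intervalIntegrable _ _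
  have itψ : IntervalIntegrable (fun t => t * ψ t) volume 0 R :=
    iψ.continuousOn_mul continuousOn_id
  -- crossing point
  have hdown : ∀ t, 0 < t → 0 < V t → ψ t ≤ V t → ∀ u, 0 < u → u < t → ψ u ≤ V u := by
    intro t ht hVt hle u hu hut
    set β := (V t) ^ ((n : ℝ)⁻¹) with hβ
    have hβ0 : 0 < β := Real.rpow_pos_of_pos hVt _
    have hβn : V t = β ^ n := by rw [hβ, Real.rpow_inv_natCast_pow hVt.le hn]
    have h1 := hconc t ht hVt β hβ0 hβn (u / t) (by positivity) ((div_lt_one ht).2 hut)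
    rw [div_mul_cancel₀ _ ht.ne'] at h1
    refine le_trans ?_ h1
    have h2 : max (1 - t / h) 0 ≤ β := by
      rw [hβn] at hle
      exact le_of_pow_le_pow_left₀ hn hβ0.le hle
    have h3 : 1 - t / h ≤ β := (le_max_left _ _).trans h2
    have h4 : u / t < 1 := (div_lt_one ht).2 hut
    have h5 : 0 < u / t := by positivity
    simp only [hψ]
    refine pow_le_pow_left₀ (le_max_right _ _) (max_le ?_ ?_) n
    · have : u / t * (1 - t / h) ≤ u / t * β := by gcongr
      have e : u / t * (1 - t / h) = u / t - u / h := by field_simp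
      linarith
    · nlinarith
  obtain ⟨τ, hτ1, hτ2⟩ : ∃ τ : ℝ, (∀ u, 0 < u → u < τ → u ≤ R → ψ u ≤ V u) ∧
      (∀ u, 0 < u → τ < u → u ≤ R → V u ≤ ψ u) := by
    set Q : Set ℝ := {t | 0 < t ∧ t ≤ R ∧ 0 < V t ∧ ψ t ≤ V t} with hQ
    have hQb : BddAbove Q := ⟨R, fun t ht => ht.2.1⟩
    have hψ0 : ∀ u, 0 ≤ ψ u := fun u => by positivity
    have hnot : ∀ u, 0 < u → u ≤ R → u ∉ Q → V u ≤ ψ u := by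
      intro u hu huR huQ
      by_contra! hc
      exact huQ ⟨hu, huR, (hψ0 u).trans_lt hc, hc.le⟩
    by_cases hne : Q.Nonempty
    · refine ⟨sSup Q, fun u hu hu' huR => ?_, fun u hu hu' huR => ?_⟩
      · obtain ⟨t, ht, hut⟩ := exists_lt_of_lt_csSup hne hu'
        exact hdown t ht.1 ht.2.2.1 ht.2.2.2 u hu hut
      · exact hnot u hu huR fun hq => absurd (le_csSup hQb hq) (not_le.2 hu')
    · rw [not_nonempty_iff_eq_empty] at hne
      refine ⟨0, fun u hu hu' => by linarith, fun u hu _ huR => hnot u hu huR (by simp [hne])⟩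
  have hmono : ∫ t in (0 : ℝ)..R, (t * V t - τ * V t) ≤ ∫ t in (0 : ℝ)..R, (t * ψ t - τ * ψ t) := by
    refine intervalIntegral.integral_mono_on_of_le_Ioo hR0.le (itV.sub (iV.const_mul _))
      (itψ.sub (iψ.const_mul _)) fun t ht => ?_
    rcases lt_trichotomy t τ with h1 | h1 | h1
    · have := hτ1 t ht.1 h1 ht.2.le
      nlinarith
    · subst h1; simp
    · have := hτ2 t ht.1 h1 ht.2.le
      nlinarith
  rw [intervalIntegral.integral_sub itV (iV.const_mul _),
    intervalIntegral.integral_sub itψ (iψ.const_mul _), intervalIntegral.integral_const_mul,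
    intervalIntegral.integral_const_mul, hint, I1, I2] at hmono
  linarith

lemma layer {Ω : Type*} [MeasurableSpace Ω] (μ : Measure Ω) [IsProbabilityMeasure μ] (w : Ω → ℝ)
    (hw : Measurable w) (R : ℝ) (hR : 0 < R) (h0 : 0 ≤ᵐ[μ] w) (h1 : ∀ᵐ x ∂μ, w x ≤ R) :
    (∫ x, w x ∂μ = ∫ t in (0 : ℝ)..R, μ.real {x | t ≤ w x}) ∧
    (∫ x, w x ^ 2 ∂μ = ∫ t in (0 : ℝ)..R, 2 * (t * μ.real {x | t ≤ w x})) := by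
  have hanti : Antitone fun t : ℝ => μ.real {x | t ≤ w x} := fun s t hst =>
    measureReal_mono fun x hx => le_trans hst hx
  have hz : ∀ t ∈ Ioi (0 : ℝ) \ Ioc 0 R, μ.real {x | t ≤ w x} = 0 := by
    intro t ht
    have htR : R < t := by
      by_contra! hc
      exact ht.2 ⟨ht.1, hc⟩
    have : μ {x | t ≤ w x} = 0 := by
      rw [← nonpos_iff_eq_zero]
      have h2 : μ {x | ¬ w x ≤ R} = 0 := h1
      rw [← h2]
      refine measure_mono fun x hx => ?_
      have hx : t ≤ w x := hx
      exact not_le.2 (htR.trans_le hx)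
    simp [Measure.real, this]
  constructor
  · have hi : Integrable w μ := by
      refine Integrable.of_bound hw.aestronglyMeasurable R ?_
      filter_upwards [h0, h1] with x hx hx'
      rw [Real.norm_of_nonneg hx]; exact hx'
    rw [hi.integral_eq_integral_meas_le h0, intervalIntegral.integral_of_le hR.le]
    exact (setIntegral_eq_of_subset_of_forall_sdiff_eq_zero measurableSet_Ioi Ioc_subset_Ioi_self
      hz)
  · rw [intervalIntegral.integral_of_le hR.le, ← setIntegral_eq_of_subset_of_forall_sdiff_eq_zero
      measurableSet_Ioi Ioc_subset_Ioi_self (fun t ht => by rw [hz t ht]; simp)]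
    have key := lintegral_comp_eq_lintegral_meas_le_mul μ h0 hw.aemeasurable (g := fun t => 2 * t)
      (fun t _ => by apply Continuous.intervalIntegrable; fun_prop)
      ((ae_restrict_iff' measurableSet_Ioi).2 (Eventually.of_forall fun t ht => by
        have : (0 : ℝ) < t := ht
        positivity))
    rw [integral_eq_lintegral_of_nonneg_ae (Eventually.of_forall fun x => sq_nonneg _)
      (hw.pow_const 2).aestronglyMeasurable, integral_eq_lintegral_of_nonneg_ae]
    · congr 1
      convert key using 1
      · refine lintegral_congr fun x => ?_
        congr 1
        rw [intervalIntegral.integral_const_mul, integral_id]; ring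
      · refine setLIntegral_congr_fun measurableSet_Ioi fun t ht => ?_
        have ht : (0 : ℝ) < t := ht
        rw [mul_comm t, mul_left_comm, ENNReal.ofReal_mul (by positivity), ofReal_measureReal]
    · refine (ae_restrict_iff' measurableSet_Ioi).2 (Eventually.of_forall fun t ht => ?_)
      have ht : (0 : ℝ) < t := ht
      simp only [Pi.zero_apply]
      positivity
    · exact ((measurable_id.mul hanti.measurable).const_mul 2).aestronglyMeasurable

lemma support_bound {n : ℕ} (hn : n ≠ 0) (K : Set (EuclideanSpace ℝ (Fin n))) (L : ℝ)
    (hconv : Convex ℝ K) (hcomp : IsCompact K) (hvol : volume K = 1) (hbar : ∫ x in K, x = 0)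
    (ξ : EuclideanSpace ℝ (Fin n)) (hξ : ‖ξ‖ = 1)
    (hiso : ∫ x in K, ⟪x, ξ⟫ ^ 2 = L ^ 2) (b : ℝ) (hb : 0 < b) (hbK : ∀ x ∈ K, ⟪x, ξ⟫ ≤ b) :
    L ^ 2 ≤ b ^ 2 * (n / (n + 2)) := by
  have hKm : MeasurableSet K := hcomp.isClosed.measurableSet
  set μ : Measure (EuclideanSpace ℝ (Fin n)) := volume.restrict K with hμ
  have : IsProbabilityMeasure μ := ⟨by simp [hμ, hvol]⟩
  set w : EuclideanSpace ℝ (Fin n) → ℝ := fun x => b - ⟪x, ξ⟫ with hw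
  have hwc : Continuous w := by fun_prop
  obtain ⟨C, hC⟩ := hcomp.isBounded.exists_norm_le
  set R := max (b + C) ((n + 1) * b) with hR
  have hR0 : 0 < R := lt_of_lt_of_le (by positivity) (le_max_right _ _)
  have hae : ∀ p : EuclideanSpace ℝ (Fin n) → Prop, (∀ x ∈ K, p x) → ∀ᵐ x ∂μ, p x := fun p hp =>
    (ae_restrict_iff' hKm).2 (Eventually.of_forall hp)
  obtain ⟨l1, l2⟩ := layer μ w hwc.measurable R hR0
    (hae _ fun x hx => by simpa [hw] using hbK x hx)
    (hae _ fun x hx => by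
      refine le_trans ?_ (le_max_left _ _)
      have h1 := abs_real_inner_le_norm x ξ
      rw [hξ, mul_one] at h1
      have := neg_abs_le (⟪x, ξ⟫)
      have := hC x hx
      simp only [hw]; linarith)
  have iid : Integrable (fun x : EuclideanSpace ℝ (Fin n) => x) μ :=
    continuous_id.continuousOn.integrableOn_compact hcomp
  have ii : Integrable (fun x : EuclideanSpace ℝ (Fin n) => ⟪x, ξ⟫) μ :=
    (by fun_prop : Continuous fun x : EuclideanSpace ℝ (Fin n) =>
      ⟪x, ξ⟫).continuousOn.integrableOn_compact hcomp
  have ii2 : Integrable (fun x : EuclideanSpace ℝ (Fin n) => ⟪x, ξ⟫ ^ 2) μ :=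
    (by fun_prop : Continuous fun x : EuclideanSpace ℝ (Fin n) =>
      ⟪x, ξ⟫ ^ 2).continuousOn.integrableOn_compact hcomp
  have m1 : ∫ x, ⟪x, ξ⟫ ∂μ = 0 := by
    have := integral_inner (𝕜 := ℝ) iid ξ
    rw [hbar, inner_zero_right] at this
    rw [← this]
    exact integral_congr_ae (Eventually.of_forall fun x => real_inner_comm _ _)
  have e1 : ∫ x, w x ∂μ = b := by
    simp only [hw]
    rw [integral_sub (integrable_const _) ii, m1]; simp
  have e2 : ∫ x, w x ^ 2 ∂μ = b ^ 2 + L ^ 2 := by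
    have : ∀ x, w x ^ 2 = b ^ 2 - 2 * b * ⟪x, ξ⟫ + ⟪x, ξ⟫ ^ 2 := fun x => by
      simp only [hw]; ring
    simp only [this]
    have ii3 : Integrable (fun x : EuclideanSpace ℝ (Fin n) => b ^ 2 - 2 * b * ⟪x, ξ⟫) μ :=
      (integrable_const _).sub (ii.const_mul _)
    rw [integral_add ii3 ii2,
      integral_sub (integrable_const _) (ii.const_mul _), integral_const_mul, m1, hiso]
    simp
  have hVeq : ∀ t, μ {x | t ≤ w x} = volume (K ∩ {x | t ≤ w x}) := by
    intro t
    rw [hμ, Measure.restrict_apply (measurableSet_le measurable_const hwc.measurable), inter_comm]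
  have key := crossing n (fun t => μ.real {x | t ≤ w x})
    (fun s t hst => measureReal_mono fun x hx => le_trans hst hx)
    b R hb (le_max_right _ _) (by rw [← l1, e1]) ?_ hn
  · rw [intervalIntegral.integral_const_mul, e2] at l2
    have hn2 : (0 : ℝ) < n + 2 := by positivity
    have : b ^ 2 * ((n : ℝ) / (n + 2)) = 2 * (((n : ℝ) + 1) / (n + 2) * b ^ 2) - b ^ 2 := by
      field_simp; ring
    linarith
  · intro t ht hVt β hβ hVβ s hs hs1
    have hB : volume (K ∩ {x | t ≤ w x}) = ENNReal.ofReal (β ^ n) := by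
      rw [← hVβ, ofReal_measureReal, hVeq]
    have := bm (n := n) (A := K) (B := K ∩ {x | t ≤ w x}) (S := K ∩ {x | s * t ≤ w x}) hKm
      (hKm.inter (measurableSet_le measurable_const hwc.measurable))
      (hKm.inter (measurableSet_le measurable_const hwc.measurable)) (a := 1 - s) (b := s)
      (α := 1) (β := β) (by linarith) hs one_pos hβ (by simp [hvol]) hB ?_
    · rw [← hVeq, mul_one] at this
      exact (ENNReal.ofReal_le_iff_le_toReal (measure_ne_top _ _)).1 this
    · rintro x hx y ⟨hy, hyt⟩
      refine ⟨hconv hx hy (by linarith) hs.le (by ring), ?_⟩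
      have hyt : t ≤ w y := hyt
      have hx0 : 0 ≤ w x := by simpa [hw] using hbK x hx
      have e : w ((1 - s) • x + s • y) = (1 - s) * w x + s * w y := by
        simp only [hw, inner_add_left, real_inner_smul_left]; ring
      change s * t ≤ w _
      rw [e]
      have : 0 ≤ (1 - s) * w x := mul_nonneg (by linarith) hx0
      have : s * t ≤ s * w y := by gcongr
      linarith

lemma closedBall_sub_body {n : ℕ} (hn : n ≠ 0) (K : Set (EuclideanSpace ℝ (Fin n))) (L : ℝ)
    (hconv : Convex ℝ K) (hcomp : IsCompact K) (hvol : volume K = 1) (hbar : ∫ x in K, x = 0)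
    (hL : 0 < L) (hiso : ∀ ξ : EuclideanSpace ℝ (Fin n), ‖ξ‖ = 1 → ∫ x in K, ⟪x, ξ⟫ ^ 2 = L ^ 2)
    (ρ : ℝ) (hρ : 0 < ρ) (hρL : ρ ^ 2 * (n / (n + 2)) = L ^ 2) :
    closedBall (0 : EuclideanSpace ℝ (Fin n)) ρ ⊆ K := by
  rw [← closure_ball _ hρ.ne', hcomp.isClosed.closure_subset_iff]
  intro y hy
  rw [mem_ball_zero_iff] at hy
  by_contra hyK
  obtain ⟨f, u, hf1, hf2⟩ := geometric_hahn_banach_closed_point hconv hcomp.isClosed hyK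
  obtain ⟨v, hv⟩ := (InnerProductSpace.toDual ℝ (EuclideanSpace ℝ (Fin n))).surjective f
  have hfv : ∀ x, f x = ⟪x, v⟫ := fun x => by
    rw [← hv, InnerProductSpace.toDual_apply_apply, real_inner_comm]
  have hKne : K.Nonempty := by
    rw [nonempty_iff_ne_empty]; rintro rfl; simp at hvol
  have hv0 : v ≠ 0 := by
    rintro rfl
    obtain ⟨x, hx⟩ := hKne
    have := hf1 x hx
    simp [hfv] at *
    linarith
  have hnv : 0 < ‖v‖ := norm_pos_iff.2 hv0
  set ξ := ‖v‖⁻¹ • v with hξ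
  have hξ1 : ‖ξ‖ = 1 := by rw [hξ, norm_smul]; simp [hnv.ne']
  have hb : 0 < (‖y‖ + ρ) / 2 := by positivity
  have key := support_bound hn K L hconv hcomp hvol hbar ξ hξ1 (hiso ξ hξ1) ((‖y‖ + ρ) / 2) hb ?_
  · rw [← hρL] at key
    have hn' : (0 : ℝ) < n := by positivity
    have h1 : ρ ^ 2 ≤ ((‖y‖ + ρ) / 2) ^ 2 := le_of_mul_le_mul_right key (by positivity)
    have h2 := abs_le_of_sq_le_sq h1 hb.le
    rw [abs_of_pos hρ] at h2
    linarith
  · intro x hx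
    have h1 : f x < f y := (hf1 x hx).trans hf2
    rw [hfv, hfv] at h1
    have h2 : ⟪x, ξ⟫ ≤ ⟪y, ξ⟫ := by
      rw [hξ, real_inner_smul_right, real_inner_smul_right]
      gcongr
    have h3 := real_inner_le_norm y ξ
    rw [hξ1, mul_one] at h3
    linarith

lemma vol_lip {n : ℕ} (f : EuclideanSpace ℝ (Fin n) → EuclideanSpace ℝ (Fin n))
    (s : Set (EuclideanSpace ℝ (Fin n))) (hf : LipschitzOnWith 1 f s) :
    volume (f '' s) ≤ volume s := by
  have h := hf.hausdorffMeasure_image_le (d := (Module.finrank ℝ (EuclideanSpace ℝ (Fin n)) : ℝ))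
    (by positivity)
  rw [Measure.isAddLeftInvariant_eq_smul (volume : Measure (EuclideanSpace ℝ (Fin n)))
    (Measure.hausdorffMeasure (Module.finrank ℝ (EuclideanSpace ℝ (Fin n)) : ℝ))]
  rw [Measure.smul_apply, Measure.smul_apply]
  simp only [ENNReal.coe_one, ENNReal.one_rpow, one_mul] at h
  exact smul_le_smul_of_nonneg_left h (by positivity)

lemma vol_expand {n : ℕ} (A T : Set (EuclideanSpace ℝ (Fin n))) (hA : Convex ℝ A)
    (hAc : IsClosed A) (hA0 : A.Nonempty) (ε : ℝ) (hε : 0 < ε) :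
    volume (T \ A) ≤ volume ((T + closedBall (0 : EuclideanSpace ℝ (Fin n)) ε) \
      (A + closedBall (0 : EuclideanSpace ℝ (Fin n)) ε)) := by
  have hproj : ∀ x : EuclideanSpace ℝ (Fin n), ∃ p ∈ A, ∀ q ∈ A, ⟪x - p, q - p⟫ ≤ 0 := by
    intro x
    obtain ⟨p, hp, hp'⟩ := exists_norm_eq_iInf_of_complete_convex hA0 hAc.isComplete hA x
    exact ⟨p, hp, (norm_eq_iInf_iff_real_inner_le_zero hA hp).1 hp'⟩
  choose p hpA hp using hproj
  set ν : EuclideanSpace ℝ (Fin n) → EuclideanSpace ℝ (Fin n) := fun x => ‖x - p x‖⁻¹ • (x - p x)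
    with hν
  have hd : ∀ x, x ∉ A → 0 < ‖x - p x‖ := by
    intro x hx
    rw [norm_pos_iff, sub_ne_zero]
    rintro h
    exact hx (h ▸ hpA x)
  have hν1 : ∀ x, x ∉ A → ‖ν x‖ = 1 := by
    intro x hx
    simp only [hν]; rw [norm_smul]; simp [(hd x hx).ne']
  have hν2 : ∀ x, x ∉ A → ⟪ν x, x - p x⟫ = ‖x - p x‖ := by
    intro x hx
    simp only [hν]; rw [real_inner_smul_left, real_inner_self_eq_norm_sq]
    have := (hd x hx).ne'
    field_simp
  have hν3 : ∀ x, ∀ q ∈ A, ⟪ν x, q - p x⟫ ≤ 0 := by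
    intro x q hq
    simp only [hν]; rw [real_inner_smul_left]
    exact mul_nonpos_of_nonneg_of_nonpos (by positivity) (hp x q hq)
  have hsub : ∀ x y, x ∉ A → y ∉ A → ⟪ν x, y - x⟫ ≤ ‖y - p y‖ - ‖x - p x‖ := by
    intro x y hx hy
    have e : y - x = (y - p y) + (p y - p x) - (x - p x) := by abel
    rw [e, inner_sub_right, inner_add_right, hν2 x hx]
    have h1 := hν3 x (p y) (hpA y)
    have h2 := real_inner_le_norm (ν x) (y - p y)
    rw [hν1 x hx, one_mul] at h2
    linarith
  set Φ : EuclideanSpace ℝ (Fin n) → EuclideanSpace ℝ (Fin n) := fun x => x + ε • ν x with hΦ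
  have hexp : ∀ x y, x ∉ A → y ∉ A → ‖x - y‖ ≤ ‖Φ x - Φ y‖ := by
    intro x y hx hy
    have h1 := hsub x y hx hy
    have h2 := hsub y x hy hx
    have h3 : 0 ≤ ⟪x - y, ν x - ν y⟫ := by
      rw [inner_sub_right, real_inner_comm, real_inner_comm (ν y)]
      have : ⟪ν x, y - x⟫ = - ⟪ν x, x - y⟫ := by rw [← inner_neg_right, neg_sub]
      linarith
    have e : Φ x - Φ y = (x - y) + ε • (ν x - ν y) := by
      simp only [hΦ, smul_sub]; abel
    rw [e]
    refine le_of_sq_le_sq ?_ (norm_nonneg _)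
    rw [norm_add_sq_real, real_inner_smul_right]
    have : 0 ≤ ε * ⟪x - y, ν x - ν y⟫ := by positivity
    nlinarith [sq_nonneg ‖ε • (ν x - ν y)‖]
  have hinj : InjOn Φ (T \ A) := by
    intro x hx y hy hxy
    have := hexp x y hx.2 hy.2
    rw [hxy, sub_self, norm_zero] at this
    exact sub_eq_zero.1 (norm_le_zero_iff.1 this)
  have himg : Φ '' (T \ A) ⊆ (T + closedBall (0 : EuclideanSpace ℝ (Fin n)) ε) \
      (A + closedBall (0 : EuclideanSpace ℝ (Fin n)) ε) := by
    rintro _ ⟨x, ⟨hxT, hxA⟩, rfl⟩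
    refine ⟨add_mem_add hxT ?_, ?_⟩
    · rw [mem_closedBall_zero_iff, norm_smul, hν1 x hxA, Real.norm_of_nonneg hε.le, mul_one]
    · rintro ⟨q, hq, e, he, hqe⟩
      rw [mem_closedBall_zero_iff] at he
      have h1 : ⟪ν x, e⟫ ≤ ε := by
        have := real_inner_le_norm (ν x) e
        rw [hν1 x hxA, one_mul] at this
        linarith
      have h2 : e = (x - p x) - (q - p x) + ε • ν x := by
        have : q + e = x + ε • ν x := hqe
        rw [eq_sub_of_add_eq' this]; abel
      rw [h2, inner_add_right, inner_sub_right, hν2 x hxA, real_inner_smul_right,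
        real_inner_self_eq_norm_sq, hν1 x hxA] at h1
      have h3 := hν3 x q hq
      have h4 := hd x hxA
      linarith
  refine le_trans ?_ (measure_mono himg)
  have hinv : (Function.invFunOn Φ (T \ A)) '' (Φ '' (T \ A)) = T \ A := by
    rw [image_image]
    ext z
    constructor
    · rintro ⟨x, hx, rfl⟩
      have e : Function.invFunOn Φ (T \ A) (Φ x) = x := hinj.leftInvOn_invFunOn hx
      simpa only [e] using hx
    · intro hz
      exact ⟨z, hz, hinj.leftInvOn_invFunOn hz⟩
  have := vol_lip (Function.invFunOn Φ (T \ A)) (Φ '' (T \ A)) ?_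
  · rwa [hinv] at this
  · refine LipschitzOnWith.of_dist_le_mul ?_
    rintro _ ⟨x, hx, rfl⟩ _ ⟨y, hy, rfl⟩
    rw [hinj.leftInvOn_invFunOn hx, hinj.leftInvOn_invFunOn hy, dist_eq_norm, dist_eq_norm]
    simpa using hexp x y hx.2 hy.2

lemma shell_bound {n : ℕ} (A T : Set (EuclideanSpace ℝ (Fin n))) (hA : Convex ℝ A)
    (hAc : IsCompact A) (hA0 : A.Nonempty) (hT : Convex ℝ T) (hTc : IsCompact T)
    (r : ℝ) (hr : 0 < r) (hrT : closedBall (0 : EuclideanSpace ℝ (Fin n)) r ⊆ T)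
    (ε : ℝ) (hε : 0 < ε) :
    volume T + volume (T ∩ ((A + closedBall (0 : EuclideanSpace ℝ (Fin n)) ε) \ A)) ≤
      ENNReal.ofReal ((1 + ε / r) ^ n) * volume T := by
  set B := closedBall (0 : EuclideanSpace ℝ (Fin n)) ε with hB
  have hBc : IsCompact B := isCompact_closedBall _ _
  have mA := hAc.isClosed.measurableSet
  have mAB := (hAc.add hBc).isClosed.measurableSet
  have mT := hTc.isClosed.measurableSet
  have hAB : A ⊆ A + B := fun x hx => ⟨x, hx, 0, by simp [hB, hε.le], add_zero x⟩
  have hTB : T ⊆ T + B := fun x hx => ⟨x, hx, 0, by simp [hB, hε.le], add_zero x⟩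
  have h1 := vol_expand A T hA hAc.isClosed hA0 ε hε
  have h2 : T + B ⊆ (1 + ε / r) • T := by
    rw [hT.add_smul zero_le_one (by positivity), one_smul]
    refine add_subset_add_left ?_
    intro e he
    rw [hB, mem_closedBall_zero_iff] at he
    refine ⟨(r / ε) • e, hrT ?_, ?_⟩
    · rw [mem_closedBall_zero_iff, norm_smul, Real.norm_of_nonneg (by positivity)]
      calc r / ε * ‖e‖ ≤ r / ε * ε := by gcongr
        _ = r := by field_simp
    · change (ε / r) • (r / ε) • e = e
      rw [smul_smul]
      have : ε / r * (r / ε) = 1 := by field_simp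
      rw [this, one_smul]
  calc volume T + volume (T ∩ ((A + B) \ A))
      = volume (T \ A) + (volume (T ∩ A) + volume (T ∩ ((A + B) \ A))) := by
        rw [← measure_inter_add_sdiff T mA]; ring
    _ = volume (T \ A) + volume (T ∩ (A + B)) := by
        congr 1
        rw [← measure_inter_add_sdiff (T ∩ (A + B)) mA]
        congr 2
        · rw [inter_assoc, inter_eq_self_of_subset_right hAB]
        · rw [inter_sdiff_assoc]
    _ ≤ volume ((T + B) \ (A + B)) + volume ((T + B) ∩ (A + B)) := by
        gcongr
    _ = volume (T + B) := by rw [add_comm, measure_inter_add_sdiff _ mAB]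
    _ ≤ volume ((1 + ε / r) • T) := measure_mono h2
    _ = _ := by
        rw [Measure.addHaar_smul, abs_of_nonneg (by positivity)]; simp

end Helpers

theorem gamma_of_uniform_measure_le {n : ℕ} (K : Set (Euc n)) (L : ℝ)
    (hK : IsConvexBody K)
    (hvol : volume K = 1)
    (hbar : ∫ x in K, x = 0)
    (hL : 0 < L)
    (hiso : ∀ ξ : Euc n, ‖ξ‖ = 1 → ∫ x in K, ⟪x, ξ⟫ ^ 2 = L ^ 2)
    (μK : Measure (Euc n))
    (hμK : μK = volume.withDensity
      (fun x => ENNReal.ofReal (Set.indicator (L⁻¹ • K) (fun _ => L ^ n) x))) :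
    Gamma μK ≤ Real.sqrt ((n : ℝ) / ((n : ℝ) + 2)) * n := by
  obtain ⟨hconv, hcomp, -⟩ := hK
  subst hμK
  have hc0 : 0 ≤ Real.sqrt ((n : ℝ) / ((n : ℝ) + 2)) * n := by positivity
  refine Real.sSup_le ?_ hc0
  rintro _ ⟨A, ⟨hA, hAc, hAi⟩, rfl⟩
  have hA0 : A.Nonempty := hAi.mono interior_subset
  rw [muPerim, liminf_eq]
  refine Real.sSup_le ?_ hc0
  intro v hv
  have hv : ∀ᶠ ε in nhdsWithin (0 : ℝ) (Ioi 0), v ≤ _ := hv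
  set T : Set (Euc n) := L⁻¹ • K with hT
  have hTcomp : IsCompact T := hcomp.smul L⁻¹
  have hTm : MeasurableSet T := hTcomp.isClosed.measurableSet
  have hTconv : Convex ℝ T := hconv.smul L⁻¹
  have hTvol : ENNReal.ofReal (L ^ n) * volume T = 1 := by
    rw [hT, Measure.addHaar_smul, hvol, mul_one, ← ENNReal.ofReal_mul (by positivity),
      abs_of_nonneg (by positivity)]
    simp [hL.ne']
  have hmeas : ∀ S : Set (Euc n), MeasurableSet S → (volume.withDensity
      (fun x => ENNReal.ofReal (Set.indicator T (fun _ => L ^ n) x))) S =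
      ENNReal.ofReal (L ^ n) * volume (T ∩ S) := by
    intro S hS
    have e : (fun x => ENNReal.ofReal (Set.indicator T (fun _ => L ^ n) x)) =
        T.indicator (fun _ => ENNReal.ofReal (L ^ n)) := by
      ext x
      by_cases hx : x ∈ T <;> simp [hx]
    rw [e, withDensity_apply _ hS, lintegral_indicator hTm, Measure.restrict_restrict hTm,
      setLIntegral_const]
  rcases Nat.eq_zero_or_pos n with hn | hn
  · subst hn
    obtain ⟨ε, hε, -⟩ := (hv.and self_mem_nhdsWithin).exists
    refine hε.trans ?_
    have : (A + closedBall (0 : Euc 0) ε) \ A = ∅ := by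
      obtain ⟨a, ha⟩ := hA0
      ext x
      simp [Subsingleton.elim x a, ha]
    rw [this]; simp
  have hn' : (0 : ℝ) < n := by exact_mod_cast hn
  set c := Real.sqrt ((n : ℝ) / ((n : ℝ) + 2)) with hc
  have hcpos : 0 < c := Real.sqrt_pos.2 (by positivity)
  have hc2 : c ^ 2 = (n : ℝ) / ((n : ℝ) + 2) := Real.sq_sqrt (by positivity)
  have hball : closedBall (0 : Euc n) (L / c) ⊆ K := by
    refine closedBall_sub_body hn.ne' K L hconv hcomp hvol hbar hL hiso (L / c) (by positivity) ?_
    rw [← hc2]; field_simp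
  have hballT : closedBall (0 : Euc n) c⁻¹ ⊆ T := by
    intro x hx
    rw [mem_closedBall_zero_iff] at hx
    refine ⟨L • x, hball ?_, by simp [smul_smul, hL.ne']⟩
    rw [mem_closedBall_zero_iff, norm_smul, Real.norm_of_nonneg hL.le, div_eq_mul_inv]
    gcongr
  have hlim : Tendsto (fun ε : ℝ => ((1 + ε * c) ^ n - 1) / ε) (nhdsWithin 0 (Ioi 0))
      (nhds (c * n)) := by
    have hd : HasDerivAt (fun ε : ℝ => (1 + ε * c) ^ n) (c * n) 0 := by
      have h1 : HasDerivAt (fun ε : ℝ => 1 + ε * c) (1 * c) 0 :=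
        ((hasDerivAt_id (0 : ℝ)).mul_const c).const_add 1
      refine (h1.pow n).congr_deriv ?_
      simp [mul_comm]
    have h2 := hd.tendsto_slope_zero_right
    refine h2.congr' (Eventually.of_forall fun ε => ?_)
    simp [div_eq_inv_mul]
  refine ge_of_tendsto hlim ?_
  filter_upwards [hv, self_mem_nhdsWithin] with ε hε hε0
  have hε0 : (0 : ℝ) < ε := hε0
  refine hε.trans ?_
  gcongr
  have hSm : MeasurableSet ((A + closedBall (0 : Euc n) ε) \ A) :=
    (hAc.add (isCompact_closedBall _ _)).isClosed.measurableSet.diff hAc.isClosed.measurableSet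
  rw [hmeas _ hSm]
  have key := shell_bound A T hA hAc hA0 hTconv hTcomp c⁻¹ (by positivity) hballT ε hε0
  have key2 : 1 + ENNReal.ofReal (L ^ n) *
      volume (T ∩ ((A + closedBall (0 : Euc n) ε) \ A)) ≤ ENNReal.ofReal ((1 + ε * c) ^ n) := by
    calc _ = ENNReal.ofReal (L ^ n) *
          (volume T + volume (T ∩ ((A + closedBall (0 : Euc n) ε) \ A))) := by
          rw [mul_add, hTvol]
      _ ≤ ENNReal.ofReal (L ^ n) * (ENNReal.ofReal ((1 + ε / c⁻¹) ^ n) * volume T) := by gcongr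
      _ = ENNReal.ofReal ((1 + ε * c) ^ n) := by
          rw [mul_left_comm, hTvol, mul_one, div_inv_eq_mul]
  have hfin := ne_top_of_le_ne_top ENNReal.ofReal_ne_top (le_add_self.trans key2)
  have := ENNReal.toReal_mono ENNReal.ofReal_ne_top key2
  rw [ENNReal.toReal_add ENNReal.one_ne_top hfin, ENNReal.toReal_ofReal (by positivity)] at this
  simp only [ENNReal.toReal_one] at this
  linarith
end
end
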